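/- Let N ≥ 1 and let A be Haar-distributed on SO(2N). Then E[ Σ_{k≥1} Tr(A^k)²/k² ] = Σ_{k≥1} (min{k, 2N} + η(k))/k², where η(k) = ε(k) + 1_{{k ≤ 2N−1}} − 1_{{k ≤ N−1}} and ε(k) = 1 if k is even and 1 ≤ k ≤ 2N−2 (and ε(k) = 0 otherwise). -/

import Mathlib

open MeasureTheory ProbabilityTheory Matrix

noncomputable section

instance matrixMeasurableSpace {m n α : Type*} [MeasurableSpace α] :
    MeasurableSpace (Matrix m n α) :=
  show MeasurableSpace (m → n → α) from inferInstance

/-- `ε(k) = 1` if `k` is even and `1 ≤ k ≤ 2N−2`, and `ε(k) = 0` otherwise. -/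
def eps (N k : ℕ) : ℝ :=
  if Even k ∧ 1 ≤ k ∧ k ≤ 2 * N - 2 then 1 else 0

/-- `η(k) = ε(k) + 1_{k ≤ 2N−1} − 1_{k ≤ N−1}`. -/
def eta (N k : ℕ) : ℝ :=
  eps N k + (if k ≤ 2 * N - 1 then 1 else 0) - (if k ≤ N - 1 then 1 else 0)

section Chebyshev

open Polynomial Polynomial.Chebyshev

theorem derivative_chebyshev_C (n : ℤ) :
    derivative (Chebyshev.C ℝ n) = (n : ℝ[X]) * Chebyshev.S ℝ (n - 1) := by
  induction n using Polynomial.Chebyshev.induct with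
  | zero => simp
  | one => simp
  | add_two n ih1 ih2 =>
    rw [Chebyshev.C_add_two, derivative_sub, derivative_mul, ih1, ih2, derivative_X]
    have h1 := Chebyshev.S_eq_X_mul_S_add_C ℝ (n : ℤ)
    have h2 := Chebyshev.S_sub_one ℝ (n : ℤ)
    rw [show (n : ℤ) + 2 - 1 = n + 1 by ring, show (n : ℤ) + 1 - 1 = n by ring, h2]
    push_cast
    linear_combination (-1 : ℝ[X]) * h1
  | neg_add_one n ih1 ih2 =>
    rw [Chebyshev.C_sub_one, derivative_sub, derivative_mul, ih1, ih2, derivative_X]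
    have h1 := Chebyshev.C_eq_S_sub_X_mul_S ℝ (-n : ℤ)
    have h2 := Chebyshev.S_sub_two ℝ (-n : ℤ)
    rw [show -(n : ℤ) + 1 - 1 = -n by ring, show -(n : ℤ) - 1 - 1 = -n - 2 by ring, h2, h1]
    push_cast
    ring

theorem chebyshev_C_sub_mul_S (k l : ℤ) :
    (Chebyshev.C ℝ (k - 1) - Chebyshev.C ℝ (k + 1)) * Chebyshev.S ℝ (l - 1) =
      Chebyshev.C ℝ (k - l) - Chebyshev.C ℝ (k + l) := by
  induction l using Polynomial.Chebyshev.induct with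
  | zero => simp
  | one => simp
  | add_two n ih1 ih2 =>
    have e := Chebyshev.S_sub_one ℝ (n : ℤ)
    have h1 := Chebyshev.C_add_two ℝ (k + n)
    have h2 := Chebyshev.C_sub_two ℝ (k - n)
    have h3 := Chebyshev.S_add_one ℝ (n : ℤ)
    rw [show (n : ℤ) + 1 - 1 = n by ring] at ih1
    rw [show (n : ℤ) + 2 - 1 = n + 1 by ring, h3,
      show k - ((n : ℤ) + 2) = k - n - 2 by ring,
        show k + ((n : ℤ) + 2) = k + n + 2 by ring, h1, h2]
    rw [show k - ((n : ℤ) + 1) = k - n - 1 by ring, show k + ((n : ℤ) + 1) = k + n + 1 by ring]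
      at ih1
    linear_combination X * ih1 - ih2
  | neg_add_one n ih1 ih2 =>
    have h1 := Chebyshev.C_sub_one ℝ (k - n)
    have h2 := Chebyshev.C_add_one ℝ (k + n)
    have h3 := Chebyshev.S_sub_two ℝ (-n : ℤ)
    rw [show -(n : ℤ) + 1 - 1 = -n by ring] at ih2
    rw [show -(n : ℤ) - 1 - 1 = -n - 2 by ring, h3,
      show k - (-(n : ℤ) - 1) = k + n + 1 by ring, show k + (-(n : ℤ) - 1) = k - n - 1 by ring, h1,
      h2]
    rw [show k - (-(n : ℤ) + 1) = k + n - 1 by ring, show k + (-(n : ℤ) + 1) = k - n + 1 by ring]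
      at ih2
    rw [show k - (-(n : ℤ)) = k + n by ring, show k + (-(n : ℤ)) = k - n by ring]
      at ih1
    linear_combination X * ih1 - ih2

theorem chebyshev_C_sub_mul_derivative (k l : ℤ) :
    (Chebyshev.C ℝ (k - 1) - Chebyshev.C ℝ (k + 1)) * derivative (Chebyshev.C ℝ l) =
      (l : ℝ[X]) * (Chebyshev.C ℝ (k - l) - Chebyshev.C ℝ (k + l)) := by
  rw [derivative_chebyshev_C]
  linear_combination (l : ℝ[X]) * chebyshev_C_sub_mul_S k l

theorem four_sub_X_sq_mul_derivative_chebyshev_C (n : ℤ) :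
    (4 - X ^ 2) * derivative (Chebyshev.C ℝ n) =
      (n : ℝ[X]) * (Chebyshev.C ℝ (n - 1) - Chebyshev.C ℝ (n + 1)) := by
  have h := chebyshev_C_sub_mul_derivative 1 n
  norm_num [Chebyshev.C_zero, Chebyshev.C_two] at h
  rw [← Chebyshev.C_neg ℝ (n - 1)]
  rw [show 1 + n = n + 1 by ring] at h
  rw [show -(n - 1) = 1 - n by ring]
  linear_combination h

/-- The Chebyshev differential equation for the rescaled polynomials `C n`. -/
theorem chebyshev_C_ode (n : ℤ) :
    (4 - X ^ 2) * derivative (derivative (Chebyshev.C ℝ n)) - X * derivative (Chebyshev.C ℝ n) =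
      -(n : ℝ[X]) ^ 2 * Chebyshev.C ℝ n := by
  have h := congrArg derivative (four_sub_X_sq_mul_derivative_chebyshev_C n)
  simp only [derivative_mul, derivative_sub, derivative_intCast, derivative_X_pow,
    derivative_ofNat] at h
  have h1 := derivative_chebyshev_C (n - 1)
  have h2 := derivative_chebyshev_C (n + 1)
  have h3 := derivative_chebyshev_C n
  rw [h1, h2] at h
  have h4 := Chebyshev.S_sub_two ℝ n
  have h5 := Chebyshev.C_eq_S_sub_X_mul_S ℝ n
  rw [show n - 1 - 1 = n - 2 by ring, show n + 1 - 1 = n by ring] at h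
  simp at h
  rw [h4] at h
  have e : (Polynomial.C 2 : ℝ[X]) = 2 := rfl
  rw [e] at h
  linear_combination h + X * h3 + (n : ℝ[X]) ^ 2 * h5
end Chebyshev

section RadialLaplacian

open MvPolynomial
open Polynomial (Chebyshev.C Chebyshev.S)

variable {N : ℕ}

/-- The `k`-th rescaled Chebyshev polynomial in the variable `X j`. -/
def cheb (k : ℤ) (j : Fin N) : MvPolynomial (Fin N) ℝ :=
  Polynomial.aeval (X j) (Chebyshev.C ℝ k)

/-- The polynomial whose value at `(2 cos θ_j)_j` is `∑_j 2 cos (k θ_j)`. -/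
def chebSum (k : ℤ) : MvPolynomial (Fin N) ℝ := ∑ j, cheb k j

/-- The carré du champ `∑_j (4 - X_j²) ∂_j f ∂_j g`, as a derivation in `g`. -/
def gam (f : MvPolynomial (Fin N) ℝ) :
    Derivation ℝ (MvPolynomial (Fin N) ℝ) (MvPolynomial (Fin N) ℝ) :=
  ∑ j, ((4 - X j ^ 2) * pderiv j f) • pderiv j

/-- The operator `∑_j (4 - X_j²) ∂_j² - X_j ∂_j`, which is `∑_j ∂²/∂θ_j²` for `X_j = 2 cos θ_j`. -/
def flatLap (f : MvPolynomial (Fin N) ℝ) : MvPolynomial (Fin N) ℝ :=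
  ∑ j, ((4 - X j ^ 2) * pderiv j (pderiv j f) - X j * pderiv j f)

/-- The alternant `det (C_{l j} (X i))`. -/
def alternant (l : Fin N → ℤ) : MvPolynomial (Fin N) ℝ :=
  (Matrix.of fun i j => cheb (l j) i).det

/-- The alternant with exponents `0, …, N - 1`, twice the Vandermonde determinant. -/
def groundAlt (N : ℕ) : MvPolynomial (Fin N) ℝ := alternant fun j => (j : ℤ)

theorem gam_apply (f g : MvPolynomial (Fin N) ℝ) :
    gam f g = ∑ j, (4 - X j ^ 2) * pderiv j f * pderiv j g := by
  have h := congrFun (map_sum (Derivation.coeFnAddMonoidHom (R := ℝ)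
    (A := MvPolynomial (Fin N) ℝ) (M := MvPolynomial (Fin N) ℝ))
    (fun j => ((4 - X j ^ 2) * pderiv j f) • pderiv j) Finset.univ) g
  refine h.trans ?_
  simp only [Finset.sum_apply, Derivation.coeFnAddMonoidHom_apply, Derivation.coe_smul,
    Pi.smul_apply, smul_eq_mul]

theorem gam_comm (f g : MvPolynomial (Fin N) ℝ) : gam f g = gam g f := by
  simp only [gam_apply]
  exact Finset.sum_congr rfl fun j _ => by ring

theorem gam_mul_left (f g h : MvPolynomial (Fin N) ℝ) :
    gam (f * g) h = f * gam g h + g * gam f h := by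
  rw [gam_comm, Derivation.leibniz, gam_comm h g, gam_comm h f]; rfl

theorem gam_add_left (f g h : MvPolynomial (Fin N) ℝ) :
    gam (f + g) h = gam f h + gam g h := by
  rw [gam_comm, map_add, gam_comm h g, gam_comm h f]

theorem gam_algebraMap_left (r : ℝ) (h : MvPolynomial (Fin N) ℝ) :
    gam (algebraMap ℝ _ r) h = 0 := by
  rw [gam_comm, Derivation.map_algebraMap]

theorem flatLap_add (f g : MvPolynomial (Fin N) ℝ) :
    flatLap (f + g) = flatLap f + flatLap g := by
  simp only [flatLap, map_add, ← Finset.sum_add_distrib]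
  exact Finset.sum_congr rfl fun j _ => by ring

theorem flatLap_algebraMap (r : ℝ) :
    flatLap (algebraMap ℝ (MvPolynomial (Fin N) ℝ) r) = 0 := by
  simp [flatLap]

theorem flatLap_mul (f g : MvPolynomial (Fin N) ℝ) :
    flatLap (f * g) = f * flatLap g + g * flatLap f + 2 * gam f g := by
  simp only [flatLap, gam_apply, Finset.mul_sum, ← Finset.sum_add_distrib]
  refine Finset.sum_congr rfl fun j _ => ?_
  simp only [Derivation.leibniz, map_add, smul_eq_mul]
  ring

theorem flatLap_smul (r : ℝ) (f : MvPolynomial (Fin N) ℝ) :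
    flatLap (r • f) = r • flatLap f := by
  rw [Algebra.smul_def, flatLap_mul, flatLap_algebraMap, gam_algebraMap_left, Algebra.smul_def]
  ring

theorem flatLap_sum {α : Type*} (s : Finset α) (f : α → MvPolynomial (Fin N) ℝ) :
    flatLap (∑ a ∈ s, f a) = ∑ a ∈ s, flatLap (f a) := by
  classical
  induction s using Finset.induction_on with
  | empty => simp [flatLap]
  | insert a s ha ih => rw [Finset.sum_insert ha, Finset.sum_insert ha, flatLap_add, ih]

theorem Derivation.map_prod_of_eigen {R A α : Type*} [CommRing R] [CommRing A] [Algebra R A]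
    (D : Derivation R A A) (s : Finset α) (f h : α → A) (H : ∀ a ∈ s, D (f a) = f a * h a) :
    D (∏ a ∈ s, f a) = (∏ a ∈ s, f a) * ∑ a ∈ s, h a := by
  classical
  induction s using Finset.induction_on with
  | empty => simp
  | insert a s ha ih =>
    rw [Finset.prod_insert ha, Finset.sum_insert ha, Derivation.leibniz,
      ih fun b hb => H b (Finset.mem_insert_of_mem hb), H a (Finset.mem_insert_self a s)]
    simp only [smul_eq_mul]
    ring

theorem pderiv_aeval_X (i j : Fin N) (p : Polynomial ℝ) :
    pderiv j (Polynomial.aeval (X i : MvPolynomial (Fin N) ℝ) p) =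
      if i = j then Polynomial.aeval (X i) (Polynomial.derivative p) else 0 := by
  rw [Derivation.map_aeval, pderiv_X]
  by_cases h : i = j
  · subst h; simp
  · simp [h]

theorem cheb_neg (k : ℤ) (j : Fin N) : cheb (-k) j = cheb k j := by
  rw [cheb, Polynomial.Chebyshev.C_neg, cheb]

theorem cheb_mul_cheb (k l : ℤ) (j : Fin N) :
    cheb k j * cheb l j = cheb (k + l) j + cheb (k - l) j := by
  simp only [cheb, ← map_mul, ← map_add, Polynomial.Chebyshev.C_mul_C]

theorem X_mul_cheb (k : ℤ) (j : Fin N) :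
    X j * cheb k j = cheb (k + 1) j + cheb (k - 1) j := by
  rw [← cheb_mul_cheb, mul_comm (cheb k j)]
  simp [cheb]

theorem cheb_zero (j : Fin N) : cheb 0 j = 2 := by
  rw [cheb, Polynomial.Chebyshev.C_zero, map_ofNat]

theorem cheb_one (j : Fin N) : cheb 1 j = X j := by simp [cheb]

theorem chebSum_neg (k : ℤ) : chebSum (N := N) (-k) = chebSum k := by
  simp [chebSum, cheb_neg]

theorem pderiv_cheb (k : ℤ) (i j : Fin N) :
    pderiv j (cheb k i) =
      if i = j then Polynomial.aeval (X i) (Polynomial.derivative (Chebyshev.C ℝ k)) else 0 := by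
  rw [cheb, pderiv_aeval_X]

theorem gam_chebSum_X (k : ℤ) (j : Fin N) :
    gam (chebSum k) (X j) = (k : MvPolynomial (Fin N) ℝ) * (cheb (k - 1) j - cheb (k + 1) j) := by
  have h := congrArg (Polynomial.aeval (X j : MvPolynomial (Fin N) ℝ))
    (four_sub_X_sq_mul_derivative_chebyshev_C k)
  simp only [map_mul, map_sub, map_pow, Polynomial.aeval_X, map_ofNat, map_intCast] at h
  simp only [gam_apply, pderiv_X, Pi.single_apply, chebSum, map_sum, pderiv_cheb]
  simp [h, cheb]

theorem gam_chebSum_aeval (k : ℤ) (j : Fin N) (p : Polynomial ℝ) :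
    gam (chebSum k) (Polynomial.aeval (X j) p) =
      (k : MvPolynomial (Fin N) ℝ) * (cheb (k - 1) j - cheb (k + 1) j) *
        Polynomial.aeval (X j) (Polynomial.derivative p) := by
  rw [Derivation.map_aeval, gam_chebSum_X, smul_eq_mul, mul_comm]

theorem gam_chebSum_chebSum (k l : ℤ) :
    gam (chebSum (N := N) k) (chebSum l) =
      (k : MvPolynomial (Fin N) ℝ) * (l : MvPolynomial (Fin N) ℝ) *
        (chebSum (k - l) - chebSum (k + l)) := by
  have h : ∀ j : Fin N, gam (chebSum k) (cheb l j) =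
      (k : MvPolynomial (Fin N) ℝ) * (l : MvPolynomial (Fin N) ℝ) *
        (cheb (k - l) j - cheb (k + l) j) := by
    intro j
    have h := congrArg (Polynomial.aeval (X j : MvPolynomial (Fin N) ℝ))
      (chebyshev_C_sub_mul_derivative k l)
    simp only [map_mul, map_sub, map_intCast] at h
    rw [cheb, gam_chebSum_aeval, mul_assoc]
    simp only [cheb, h]
    ring
  rw [show chebSum (N := N) l = ∑ j, cheb l j from rfl, map_sum,
    Finset.sum_congr rfl fun j _ => h j, ← Finset.mul_sum, Finset.sum_sub_distrib]
  rfl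

theorem flatLap_cheb (k : ℤ) (i : Fin N) :
    flatLap (cheb k i) = -(k : MvPolynomial (Fin N) ℝ) ^ 2 * cheb k i := by
  have h := congrArg (Polynomial.aeval (X i : MvPolynomial (Fin N) ℝ)) (chebyshev_C_ode k)
  simp only [map_mul, map_sub, map_pow, Polynomial.aeval_X, map_ofNat, map_neg, map_intCast] at h
  rw [flatLap, Finset.sum_eq_single i]
  · rw [pderiv_cheb, if_pos rfl, pderiv_aeval_X, if_pos rfl, h, cheb]
  · intro j _ hj
    rw [pderiv_cheb, if_neg (Ne.symm hj)]
    simp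
  · simp

theorem flatLap_chebSum (k : ℤ) :
    flatLap (chebSum (N := N) k) = -(k : MvPolynomial (Fin N) ℝ) ^ 2 * chebSum k := by
  rw [chebSum, flatLap_sum, Finset.mul_sum]
  exact Finset.sum_congr rfl fun j _ => flatLap_cheb k j

theorem gam_cheb_cheb_of_ne (k l : ℤ) {i j : Fin N} (h : i ≠ j) :
    gam (cheb k i) (cheb l j) = 0 := by
  rw [gam_apply]
  refine Finset.sum_eq_zero fun a _ => ?_
  rw [pderiv_cheb, pderiv_cheb]
  split_ifs with h1 h2
  · exact absurd (h1.trans h2.symm) h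
  all_goals simp

theorem flatLap_prod_cheb (l : Fin N → ℤ) (σ : Equiv.Perm (Fin N)) (s : Finset (Fin N)) :
    flatLap (∏ i ∈ s, cheb (l i) (σ i)) =
      -(∑ i ∈ s, (l i : MvPolynomial (Fin N) ℝ) ^ 2) * ∏ i ∈ s, cheb (l i) (σ i) := by
  induction s using Finset.induction_on with
  | empty => simpa using flatLap_algebraMap (N := N) 1
  | insert a s ha ih =>
    have h0 : gam (cheb (l a) (σ a)) (∏ i ∈ s, cheb (l i) (σ i)) = 0 := by
      rw [Derivation.map_prod_of_eigen _ s _ (fun _ => 0), Finset.sum_const_zero, mul_zero]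
      intro b hb
      rw [mul_zero]
      exact gam_cheb_cheb_of_ne _ _ fun h => ha (σ.injective h ▸ hb)
    rw [Finset.prod_insert ha, Finset.sum_insert ha, flatLap_mul, ih, h0, flatLap_cheb]
    ring

theorem alternant_eq_sum (l : Fin N → ℤ) :
    alternant l = ∑ σ : Equiv.Perm (Fin N),
      ((Equiv.Perm.sign σ : ℤ) : MvPolynomial (Fin N) ℝ) * ∏ i, cheb (l i) (σ i) := by
  rw [alternant, Matrix.det_apply']
  rfl

theorem flatLap_alternant (l : Fin N → ℤ) :
    flatLap (alternant l) = -(∑ i, (l i : ℝ) ^ 2) • alternant l := by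
  rw [alternant_eq_sum, flatLap_sum, Finset.smul_sum]
  refine Finset.sum_congr rfl fun σ _ => ?_
  have e : ((Equiv.Perm.sign σ : ℤ) : MvPolynomial (Fin N) ℝ) =
      algebraMap ℝ _ ((Equiv.Perm.sign σ : ℤ) : ℝ) := by simp
  rw [e, ← Algebra.smul_def, flatLap_smul, flatLap_prod_cheb, smul_comm]
  congr 1
  rw [Algebra.smul_def]
  simp

theorem chebSum_mul_alternant (k : ℤ) (l : Fin N → ℤ) :
    chebSum k * alternant l =
      ∑ j, (alternant (Function.update l j (l j + k)) +
        alternant (Function.update l j (l j - k))) := by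
  simp only [alternant_eq_sum, ← Finset.sum_add_distrib]
  rw [Finset.sum_comm, Finset.mul_sum]
  refine Finset.sum_congr rfl fun σ _ => ?_
  have hp : ∀ (j : Fin N) (a : ℤ), ∏ i, cheb (Function.update l j a i) (σ i) =
      cheb a (σ j) * ∏ i ∈ Finset.univ.erase j, cheb (l i) (σ i) := by
    intro j a
    rw [← Finset.mul_prod_erase _ _ (Finset.mem_univ j), Function.update_self]
    congr 1
    refine Finset.prod_congr rfl fun i hi => ?_
    rw [Function.update_of_ne (Finset.ne_of_mem_erase hi)]
  have hs : chebSum (N := N) k = ∑ j, cheb k (σ j) := (Equiv.sum_comp σ fun j => cheb k j).symm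
  rw [hs, Finset.sum_mul]
  refine Finset.sum_congr rfl fun j _ => ?_
  rw [hp, hp, ← Finset.mul_prod_erase Finset.univ (fun i => cheb (l i) (σ i)) (Finset.mem_univ j)]
  linear_combination ((Equiv.Perm.sign σ : ℤ) : MvPolynomial (Fin N) ℝ) *
    (∏ i ∈ Finset.univ.erase j, cheb (l i) (σ i)) * cheb_mul_cheb (l j) k (σ j)

end RadialLaplacian

section Vandermonde

open MvPolynomial
open Polynomial (Chebyshev.C Chebyshev.S)

variable {N : ℕ}

theorem chebyshev_C_monic_natDegree (n : ℕ) :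
    (Chebyshev.C ℝ (n + 1)).Monic ∧ (Chebyshev.C ℝ (n + 1)).natDegree = n + 1 := by
  induction n using Nat.strong_induction_on with
  | _ n ih =>
    match n, ih with
    | 0, _ => simp
    | 1, _ =>
      norm_num [Polynomial.Chebyshev.C_two]
      constructor
      · exact Polynomial.monic_X_pow_sub_C (2 : ℝ) two_ne_zero
      · exact Polynomial.natDegree_X_pow_sub_C (n := 2) (r := (2 : ℝ))
    | n + 2, ih =>
      obtain ⟨m1, d1⟩ := ih (n + 1) (by omega)
      obtain ⟨m0, d0⟩ := ih n (by omega)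
      have e : Chebyshev.C ℝ ((n + 2 : ℕ) + 1) =
          Polynomial.X * Chebyshev.C ℝ ((n + 1 : ℕ) + 1) - Chebyshev.C ℝ (n + 1) := by
        have := Polynomial.Chebyshev.C_add_two ℝ ((n : ℤ) + 1)
        push_cast
        rw [show (n : ℤ) + 2 + 1 = n + 1 + 2 by ring, this]
      have mX := Polynomial.monic_X.mul m1
      have dX : (Polynomial.X * Chebyshev.C ℝ ((n + 1 : ℕ) + 1)).natDegree = n + 3 := by
        rw [Polynomial.monic_X.natDegree_mul m1, Polynomial.natDegree_X, d1]; ring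
      have hlt : (Chebyshev.C ℝ ((n : ℤ) + 1)).degree <
          (Polynomial.X * Chebyshev.C ℝ ((n + 1 : ℕ) + 1)).degree := by
        rw [Polynomial.degree_eq_natDegree mX.ne_zero, Polynomial.degree_eq_natDegree m0.ne_zero,
          dX, d0]
        exact_mod_cast (by omega : n + 1 < n + 3)
      rw [e]
      refine ⟨mX.sub_of_left hlt, ?_⟩
      rw [Polynomial.natDegree_sub_eq_left_of_natDegree_lt, dX]
      rw [dX, d0]
      omega

theorem groundAlt_eq_vandermonde (N : ℕ) :
    ∃ r : ℝ, r ≠ 0 ∧ groundAlt N = r • (∏ i : Fin N, ∏ j ∈ Finset.Ioi i,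
      (X j - X i : MvPolynomial (Fin N) ℝ)) := by
  let Q : Fin N → Polynomial ℝ := fun j => if (j : ℕ) = 0 then 1 else Chebyshev.C ℝ (j : ℕ)
  have hQ : ∀ j : Fin N, (Q j).Monic ∧ (Q j).natDegree = j := by
    intro j
    by_cases h : (j : ℕ) = 0
    · simp [Q, h]
    · obtain ⟨m, hm⟩ := Nat.exists_eq_succ_of_ne_zero h
      simp only [Q, if_neg h, hm]
      simpa using chebyshev_C_monic_natDegree m
  let r : Fin N → ℝ := fun j => if (j : ℕ) = 0 then 2 else 1
  refine ⟨∏ j, r j, Finset.prod_ne_zero_iff.mpr fun j _ => ?_, ?_⟩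
  · simp only [r]; split_ifs <;> norm_num
  have h1 : (Matrix.of fun i j : Fin N => cheb ((j : ℕ) : ℤ) i) =
      Matrix.of fun i j => (algebraMap ℝ (MvPolynomial (Fin N) ℝ) (r j)) *
        (Matrix.of fun i j : Fin N => ((Q j).map (algebraMap ℝ (MvPolynomial (Fin N) ℝ))).eval
          (X i)) i j := by
    ext1 i j
    simp only [Matrix.of_apply, Polynomial.eval_map_algebraMap, r, Q]
    split_ifs with h
    · rw [h, Nat.cast_zero, cheb_zero]; simp; rfl
    · simp [cheb]
  rw [groundAlt, alternant, h1, Matrix.det_mul_row,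
    ← Matrix.det_eval_matrixOfPolynomials_eq_det_vandermonde _ _ _ _, Matrix.det_vandermonde,
    ← map_prod, ← Algebra.smul_def]
  · intro j
    rw [(hQ j).1.natDegree_map, (hQ j).2]
  · intro j
    exact (hQ j).1.map _

theorem groundAlt_ne_zero (N : ℕ) : groundAlt N ≠ 0 := by
  obtain ⟨r, hr, h⟩ := groundAlt_eq_vandermonde N
  rw [h]
  refine smul_ne_zero hr (Finset.prod_ne_zero_iff.mpr fun i _ =>
    Finset.prod_ne_zero_iff.mpr fun j hj => ?_)
  rw [sub_ne_zero]
  intro e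
  exact (Finset.mem_Ioi.mp hj).ne' (X_injective e)

/-- A Christoffel–Darboux type identity for the polynomials `C n`. -/
theorem sub_mul_sum_cheb (k : ℕ) (i j : Fin N) :
    (X j - X i) * ∑ m ∈ Finset.range k,
      (cheb (m : ℤ) i * cheb ((k : ℤ) - m) j + cheb (m : ℤ) j * cheb ((k : ℤ) - m) i) =
    2 * ((cheb ((k : ℤ) + 1) j - cheb ((k : ℤ) - 1) j) -
      (cheb ((k : ℤ) + 1) i - cheb ((k : ℤ) - 1) i)) := by
  have key : ∀ n : ℕ, (X j - X i) * ∑ m ∈ Finset.range n,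
      (cheb (m : ℤ) i * cheb ((k : ℤ) - m) j + cheb (m : ℤ) j * cheb ((k : ℤ) - m) i) =
      (cheb (n : ℤ) j * cheb ((k : ℤ) + 1 - n) i - cheb (n : ℤ) i * cheb ((k : ℤ) + 1 - n) j +
        cheb ((n : ℤ) - 1) i * cheb ((k : ℤ) - n) j - cheb ((n : ℤ) - 1) j * cheb ((k : ℤ) - n) i)
      - (cheb 0 j * cheb ((k : ℤ) + 1) i - cheb 0 i * cheb ((k : ℤ) + 1) j +
        cheb (-1) i * cheb (k : ℤ) j - cheb (-1) j * cheb (k : ℤ) i) := by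
    intro n
    induction n with
    | zero => simp
    | succ n ih =>
      rw [Finset.sum_range_succ, mul_add, ih]
      have h1 := X_mul_cheb (n : ℤ) i
      have h2 := X_mul_cheb (n : ℤ) j
      have h3 := X_mul_cheb ((k : ℤ) - n) i
      have h4 := X_mul_cheb ((k : ℤ) - n) j
      push_cast
      rw [show (k : ℤ) + 1 - n = k - n + 1 by ring, show (k : ℤ) + 1 - (n + 1) = k - n by ring,
        show (n : ℤ) + 1 - 1 = n by ring, show (k : ℤ) - (n + 1) = k - n - 1 by ring]
      linear_combination cheb (n : ℤ) i * h4 - cheb (n : ℤ) j * h3 + cheb ((k : ℤ) - n) i * h2 -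
        cheb ((k : ℤ) - n) j * h1
  rw [key k, show (k : ℤ) + 1 - k = 1 by ring, sub_self, cheb_neg, cheb_neg, cheb_one, cheb_one,
    cheb_zero, cheb_zero]
  ring

theorem sum_offDiag_cheb (a b : ℤ) :
    ∑ i : Fin N, ∑ j ∈ Finset.Ioi i, (cheb a i * cheb b j + cheb a j * cheb b i) =
      chebSum a * chebSum b - chebSum (a + b) - chebSum (a - b) := by
  have h := Finset.sum_sum_Ioi_add_eq_sum_sum_off_diag (α := Fin N)
    fun j i => cheb (N := N) a i * cheb b j
  have h' : ∑ i : Fin N, ∑ j ∈ Finset.Ioi i, (cheb a i * cheb b j + cheb a j * cheb b i) =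
      ∑ i : Fin N, ∑ j ∈ {i}ᶜ, cheb a i * cheb b j := by
    rw [← h]
  rw [h']
  simp only [chebSum]
  rw [Finset.sum_mul_sum, ← Finset.sum_sub_distrib, ← Finset.sum_sub_distrib]
  refine Finset.sum_congr rfl fun i _ => ?_
  rw [← Finset.sum_add_sum_compl {i} fun j => cheb a i * cheb b j, Finset.sum_singleton,
    cheb_mul_cheb]
  ring

/-- The drift polynomial of the Laplacian of `SO(2N)` on the `k`-th power trace, divided by `k`. -/
def drift (k : ℕ) : MvPolynomial (Fin N) ℝ :=
  ∑ m ∈ Finset.range k, (chebSum ((k : ℤ) - 2 * m) - chebSum (m : ℤ) * chebSum ((k : ℤ) - m))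

theorem two_mul_gam_chebSum_groundAlt (k : ℕ) :
    2 * gam (chebSum k) (groundAlt N) = groundAlt N * ((k : MvPolynomial (Fin N) ℝ) *
      ∑ m ∈ Finset.range k, (chebSum (k : ℤ) + chebSum ((k : ℤ) - 2 * m) -
        chebSum (m : ℤ) * chebSum ((k : ℤ) - m))) := by
  obtain ⟨r, -, hr⟩ := groundAlt_eq_vandermonde N
  let D := (2 : MvPolynomial (Fin N) ℝ) • gam (N := N) (chebSum k)
  let E : Fin N → Fin N → MvPolynomial (Fin N) ℝ := fun i j => ∑ m ∈ Finset.range k,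
      (cheb (m : ℤ) i * cheb ((k : ℤ) - m) j + cheb (m : ℤ) j * cheb ((k : ℤ) - m) i)
  have h1 : ∀ i j : Fin N, D (X j - X i) =
      (X j - X i) * (-(k : MvPolynomial (Fin N) ℝ) * E i j) := by
    intro i j
    simp only [D, Derivation.coe_smul, Pi.smul_apply, smul_eq_mul, map_sub, gam_chebSum_X]
    have h := sub_mul_sum_cheb k i j
    push_cast
    linear_combination (k : MvPolynomial (Fin N) ℝ) * h
  have h2 : D (groundAlt N) =
      groundAlt N * ∑ i : Fin N, ∑ j ∈ Finset.Ioi i, (-(k : MvPolynomial (Fin N) ℝ) * E i j) := by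
    rw [hr, Derivation.map_smul, Derivation.map_prod_of_eigen D _ _ _ fun i _ =>
      Derivation.map_prod_of_eigen D (Finset.Ioi i) _ _ fun j _ => h1 i j, smul_mul_assoc]
  have h3 : ∑ i : Fin N, ∑ j ∈ Finset.Ioi i, (-(k : MvPolynomial (Fin N) ℝ) * E i j) =
      (k : MvPolynomial (Fin N) ℝ) * ∑ m ∈ Finset.range k, (chebSum (k : ℤ) +
        chebSum ((k : ℤ) - 2 * m) - chebSum (m : ℤ) * chebSum ((k : ℤ) - m)) := by
    simp only [← Finset.mul_sum, E]
    rw [neg_mul, ← mul_neg]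
    congr 1
    rw [Finset.sum_congr rfl fun i _ => Finset.sum_comm, Finset.sum_comm, ← Finset.sum_neg_distrib]
    refine Finset.sum_congr rfl fun m _ => ?_
    rw [sum_offDiag_cheb, show (m : ℤ) + (k - m) = k by ring,
      show (m : ℤ) - (k - m) = -(k - 2 * m) by ring, chebSum_neg]
    ring
  rw [← h3, ← h2]
  rfl

theorem groundAlt_mul_drift (k : ℕ) :
    groundAlt N * ((k : MvPolynomial (Fin N) ℝ) * drift k) =
      groundAlt N * flatLap (chebSum (k : ℤ)) + 2 * gam (chebSum (k : ℤ)) (groundAlt N) := by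
  rw [two_mul_gam_chebSum_groundAlt, flatLap_chebSum, drift]
  simp only [add_sub_assoc, Finset.sum_add_distrib, Finset.sum_const, Finset.card_range]
  push_cast
  rw [nsmul_eq_mul]
  ring

end Vandermonde

section Invariants

open MvPolynomial

variable {N : ℕ}

/-- The algebra generated by the power traces `chebSum k`. -/
def traceAlgebra (N : ℕ) : Subalgebra ℝ (MvPolynomial (Fin N) ℝ) :=
  Algebra.adjoin ℝ (Set.range fun k : ℕ => chebSum (k : ℤ))

theorem chebSum_mem_traceAlgebra (k : ℤ) : chebSum k ∈ traceAlgebra N := by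
  have h : chebSum (N := N) k = chebSum (k.natAbs : ℤ) := by
    rcases Int.natAbs_eq k with h | h
    · rw [← h]
    · conv_lhs => rw [h]
      rw [chebSum_neg]
  rw [h]
  exact Algebra.subset_adjoin ⟨_, rfl⟩

theorem drift_mem_traceAlgebra (k : ℕ) : drift k ∈ traceAlgebra N :=
  Subalgebra.sum_mem _ fun _ _ => Subalgebra.sub_mem _ (chebSum_mem_traceAlgebra _)
    (Subalgebra.mul_mem _ (chebSum_mem_traceAlgebra _) (chebSum_mem_traceAlgebra _))

theorem gam_chebSum_mem_traceAlgebra (k : ℤ) {g : MvPolynomial (Fin N) ℝ}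
    (hg : g ∈ traceAlgebra N) : gam (chebSum k) g ∈ traceAlgebra N := by
  induction hg using Algebra.adjoin_induction with
  | mem x hx =>
    obtain ⟨l, rfl⟩ := hx
    simp only [gam_chebSum_chebSum]
    exact Subalgebra.mul_mem _ (Subalgebra.mul_mem _ (Subalgebra.intCast_mem _ _)
      (Subalgebra.intCast_mem _ _))
      (Subalgebra.sub_mem _ (chebSum_mem_traceAlgebra _) (chebSum_mem_traceAlgebra _))
  | algebraMap r => rw [Derivation.map_algebraMap]; exact Subalgebra.zero_mem _
  | add x y _ _ h1 h2 => rw [map_add]; exact Subalgebra.add_mem _ h1 h2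
  | mul x y hx hy h1 h2 =>
    rw [Derivation.leibniz, smul_eq_mul, smul_eq_mul]
    exact Subalgebra.add_mem _ (Subalgebra.mul_mem _ hx h2) (Subalgebra.mul_mem _ hy h1)

/-- A functional satisfying the first order Schwinger–Dyson equations satisfies the second order
ones. -/
theorem exists_laplacian (E : MvPolynomial (Fin N) ℝ →ₗ[ℝ] ℝ)
    (hE : ∀ k : ℕ, ∀ g ∈ traceAlgebra N,
      E (g * ((k : MvPolynomial (Fin N) ℝ) * drift k) + gam (chebSum (k : ℤ)) g) = 0)
    {f : MvPolynomial (Fin N) ℝ} (hf : f ∈ traceAlgebra N) :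
    ∃ h ∈ traceAlgebra N, groundAlt N * h = groundAlt N * flatLap f + 2 * gam f (groundAlt N) ∧
      ∀ g ∈ traceAlgebra N, gam f g ∈ traceAlgebra N ∧ E (g * h + gam f g) = 0 := by
  induction hf using Algebra.adjoin_induction with
  | mem x hx =>
    obtain ⟨k, rfl⟩ := hx
    exact ⟨(k : MvPolynomial (Fin N) ℝ) * drift k, Subalgebra.mul_mem _ (Subalgebra.natCast_mem _ _)
      (drift_mem_traceAlgebra k), groundAlt_mul_drift k, fun g hg =>
      ⟨gam_chebSum_mem_traceAlgebra _ hg, hE k g hg⟩⟩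
  | algebraMap r =>
    refine ⟨0, Subalgebra.zero_mem _, ?_, fun g _ => ?_⟩
    · rw [flatLap_algebraMap, gam_algebraMap_left, mul_zero, mul_zero, add_zero]
    · rw [gam_algebraMap_left, mul_zero, add_zero, map_zero]
      exact ⟨Subalgebra.zero_mem _, rfl⟩
  | add x y _ _ h1 h2 =>
    obtain ⟨a, ha, ha1, ha2⟩ := h1
    obtain ⟨b, hb, hb1, hb2⟩ := h2
    refine ⟨a + b, Subalgebra.add_mem _ ha hb, ?_, fun g hg => ⟨?_, ?_⟩⟩
    · rw [flatLap_add, gam_add_left]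
      linear_combination ha1 + hb1
    · rw [gam_add_left]
      exact Subalgebra.add_mem _ (ha2 g hg).1 (hb2 g hg).1
    · rw [gam_add_left, show g * (a + b) + (gam x g + gam y g) =
        (g * a + gam x g) + (g * b + gam y g) by ring, map_add, (ha2 g hg).2, (hb2 g hg).2,
        add_zero]
  | mul x y hx hy h1 h2 =>
    obtain ⟨a, ha, ha1, ha2⟩ := h1
    obtain ⟨b, hb, hb1, hb2⟩ := h2
    refine ⟨x * b + y * a + 2 * gam x y, ?_, ?_, fun g hg => ⟨?_, ?_⟩⟩
    · rw [two_mul]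
      exact Subalgebra.add_mem _ (Subalgebra.add_mem _ (Subalgebra.mul_mem _ hx hb)
        (Subalgebra.mul_mem _ hy ha)) (Subalgebra.add_mem _ (ha2 y hy).1 (ha2 y hy).1)
    · rw [flatLap_mul, gam_mul_left]
      linear_combination x * hb1 + y * ha1
    · rw [gam_mul_left]
      exact Subalgebra.add_mem _ (Subalgebra.mul_mem _ hx (hb2 g hg).1)
        (Subalgebra.mul_mem _ hy (ha2 g hg).1)
    · have e1 := (hb2 (g * x) (Subalgebra.mul_mem _ hg hx)).2
      have e2 := (ha2 (g * y) (Subalgebra.mul_mem _ hg hy)).2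
      rw [Derivation.leibniz, smul_eq_mul, smul_eq_mul] at e1 e2
      rw [gam_mul_left, show g * (x * b + y * a + 2 * gam x y) + (x * gam y g + y * gam x g) =
        (g * x * b + (g * gam y x + x * gam y g)) + (g * y * a + (g * gam x y + y * gam x g)) by
          rw [gam_comm y x]; ring, map_add, e1, e2, add_zero]

/-- If `groundAlt N * f` is a sum of eigenvectors of `flatLap`, then `E f` only sees the multiples
of the ground state. -/
theorem expectation_eq_sum_of_eigen (E : MvPolynomial (Fin N) ℝ →ₗ[ℝ] ℝ) (hE1 : E 1 = 1)
    (hE : ∀ k : ℕ, ∀ g ∈ traceAlgebra N,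
      E (g * ((k : MvPolynomial (Fin N) ℝ) * drift k) + gam (chebSum (k : ℤ)) g) = 0)
    {α : Type*} (s : Finset α) (κ : α → ℝ) (κ₀ : ℝ)
    (hκ₀ : flatLap (groundAlt N) = -κ₀ • groundAlt N)
    (a : α → MvPolynomial (Fin N) ℝ) (n : α → ℝ)
    (ha : ∀ i ∈ s, flatLap (a i) = -κ i • a i)
    (hn : ∀ i ∈ s, (κ i ≠ κ₀ ∧ n i = 0) ∨ (κ i = κ₀ ∧ a i = n i • groundAlt N))
    (f : MvPolynomial (Fin N) ℝ) (hf : f ∈ traceAlgebra N)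
    (hsum : groundAlt N * f = ∑ i ∈ s, a i) : E f = ∑ i ∈ s, n i := by
  classical
  induction s using Finset.induction_on generalizing f a n with
  | empty =>
    rw [Finset.sum_empty] at hsum
    rw [(mul_eq_zero.mp hsum).resolve_left (groundAlt_ne_zero N), map_zero, Finset.sum_empty]
  | insert i s hi ih =>
    rw [Finset.sum_insert hi] at hsum
    rw [Finset.sum_insert hi]
    have ha' := fun j (hj : j ∈ s) => ha j (Finset.mem_insert_of_mem hj)
    have hn' := fun j (hj : j ∈ s) => hn j (Finset.mem_insert_of_mem hj)
    rcases hn i (Finset.mem_insert_self i s) with ⟨h1, h2⟩ | ⟨h1, h2⟩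
    · obtain ⟨h, hh, hV, hEh⟩ := exists_laplacian E hE hf
      have hEh0 : E h = 0 := by
        have := (hEh 1 (Subalgebra.one_mem _)).2
        rwa [Derivation.map_one_eq_zero, add_zero, one_mul] at this
      have hV2 : groundAlt N * h = ∑ j ∈ insert i s, (κ₀ - κ j) • a j := by
        have e : groundAlt N * h = flatLap (groundAlt N * f) - f * flatLap (groundAlt N) := by
          rw [hV, flatLap_mul, gam_comm f]; ring
        rw [e, hsum, ← Finset.sum_insert hi, flatLap_sum, hκ₀, Finset.sum_congr rfl ha]
        have : f * -κ₀ • groundAlt N = ∑ j ∈ insert i s, -κ₀ • a j := by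
          rw [← Finset.smul_sum, Finset.sum_insert hi, ← hsum, mul_smul_comm, mul_comm]
        rw [this, ← Finset.sum_sub_distrib]
        refine Finset.sum_congr rfl fun j _ => ?_
        rw [← sub_smul]
        congr 1
        ring
      have key := ih (fun j => (κ i - κ j) • a j) (fun j => (κ i - κ j) * n j)
        (fun j hj => by rw [flatLap_smul, ha' j hj, smul_comm])
        (fun j hj => by
          rcases hn' j hj with ⟨h3, h4⟩ | ⟨h3, h4⟩
          · exact Or.inl ⟨h3, by rw [h4, mul_zero]⟩
          · exact Or.inr ⟨h3, by rw [h4, smul_smul]⟩)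
        (h - (κ₀ - κ i) • f) (Subalgebra.sub_mem _ hh (Subalgebra.smul_mem _ hf _)) (by
          rw [mul_sub, hV2, mul_smul_comm, hsum, ← Finset.sum_insert hi, Finset.smul_sum,
            ← Finset.sum_sub_distrib, Finset.sum_insert hi, sub_self, zero_add]
          refine Finset.sum_congr rfl fun j _ => ?_
          rw [← sub_smul]
          congr 1
          ring)
      have e3 : ∑ j ∈ s, (κ i - κ j) * n j = (κ i - κ₀) * ∑ j ∈ s, n j := by
        rw [Finset.mul_sum]
        refine Finset.sum_congr rfl fun j hj => ?_
        rcases hn' j hj with ⟨_, h4⟩ | ⟨h3, _⟩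
        · rw [h4, mul_zero, mul_zero]
        · rw [h3]
      rw [e3, map_sub, hEh0, map_smul, smul_eq_mul] at key
      rw [h2, zero_add]
      refine mul_left_cancel₀ (sub_ne_zero.mpr h1) ?_
      linear_combination key
    · have key := ih a n ha' hn' (f - algebraMap ℝ _ (n i))
        (Subalgebra.sub_mem _ hf (Subalgebra.algebraMap_mem _ _)) (by
          rw [mul_sub, hsum, h2, Algebra.smul_def]; ring)
      rw [map_sub, Algebra.algebraMap_eq_smul_one, map_smul, hE1, smul_eq_mul, mul_one] at key
      linarith

end Invariants

section AlternantCoefficients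

variable {N : ℕ}

/-- The coefficient of `groundAlt N` in `alternant l`. -/
def altCoeff (l : Fin N → ℤ) : ℝ :=
  (Matrix.of fun i j : Fin N => if (l j).natAbs = i then (1 : ℝ) else 0).det

theorem sum_range_sq_lt_sum_sq {s : Finset ℕ} {a : ℕ} (ha : a ∈ s) (h : s.card ≤ a) :
    ∑ i ∈ Finset.range s.card, i ^ 2 < ∑ i ∈ s, i ^ 2 := by
  classical
  set n := s.card with hn
  have hc : (s \ Finset.range n).card = (Finset.range n \ s).card := by
    refine Finset.card_sdiff_comm ?_
    rw [Finset.card_range]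
  have hpos : 0 < (s \ Finset.range n).card := Finset.card_pos.mpr ⟨a, by simp [ha, h]⟩
  have h1 := Finset.sum_inter_add_sum_sdiff s (Finset.range n) (fun i => i ^ 2)
  have h2 := Finset.sum_inter_add_sum_sdiff (Finset.range n) s (fun i => i ^ 2)
  rw [Finset.inter_comm] at h2
  have h3 : (s \ Finset.range n).card • n ^ 2 ≤ ∑ i ∈ s \ Finset.range n, i ^ 2 :=
    Finset.card_nsmul_le_sum _ _ _ fun i hi => by
      simp only [Finset.mem_sdiff, Finset.mem_range, not_lt] at hi
      exact Nat.pow_le_pow_left hi.2 2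
  have h4 : ∑ i ∈ Finset.range n \ s, i ^ 2 ≤ (Finset.range n \ s).card • (n - 1) ^ 2 :=
    Finset.sum_le_card_nsmul _ _ _ fun i hi => by
      simp only [Finset.mem_sdiff, Finset.mem_range] at hi
      exact Nat.pow_le_pow_left (by omega) 2
  have h5 : (n - 1) ^ 2 < n ^ 2 :=
    Nat.pow_lt_pow_left (by have := Finset.card_pos.mpr ⟨a, ha⟩; omega) two_ne_zero
  rw [← hc] at h4
  have h6 := Nat.mul_lt_mul_of_pos_left h5 hpos
  simp only [smul_eq_mul] at h3 h4
  omega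

theorem cheb_natAbs (k : ℤ) (j : Fin N) : cheb (k.natAbs : ℤ) j = cheb k j := by
  rcases Int.natAbs_eq k with h | h
  · rw [← h]
  · conv_rhs => rw [h]
    rw [cheb_neg]

theorem alternant_dichotomy (l : Fin N → ℤ) :
    (∑ i, (l i : ℝ) ^ 2 ≠ ∑ i : Fin N, (((i : ℕ) : ℤ) : ℝ) ^ 2 ∧ altCoeff l = 0) ∨
      (∑ i, (l i : ℝ) ^ 2 = ∑ i : Fin N, (((i : ℕ) : ℤ) : ℝ) ^ 2 ∧
        alternant l = altCoeff l • groundAlt N) := by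
  by_cases hinj : Function.Injective fun i => (l i).natAbs
  · by_cases hlt : ∀ i, (l i).natAbs < N
    · right
      let f : Fin N → Fin N := fun i => ⟨(l i).natAbs, hlt i⟩
      have hf : Function.Injective f := fun i j h => hinj (congrArg Fin.val h)
      let σ : Equiv.Perm (Fin N) := Equiv.ofBijective f (Finite.injective_iff_bijective.mp hf)
      have hσ : ∀ i, ((σ i : Fin N) : ℕ) = (l i).natAbs := fun i => rfl
      constructor
      · rw [← Equiv.sum_comp σ fun i : Fin N => (((i : ℕ) : ℤ) : ℝ) ^ 2]
        refine Finset.sum_congr rfl fun i _ => ?_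
        rw [hσ]
        push_cast
        rw [sq_abs]
      · have h1 : altCoeff l = ((Equiv.Perm.sign σ : ℤ) : ℝ) := by
          have : (Matrix.of fun i j : Fin N => if (l j).natAbs = i then (1 : ℝ) else 0) =
              (1 : Matrix (Fin N) (Fin N) ℝ).submatrix id σ := by
            ext i j
            simp only [Matrix.of_apply, Matrix.submatrix_apply, id, Matrix.one_apply, ← hσ,
              Fin.ext_iff, eq_comm]
          rw [altCoeff, this, Matrix.det_permute', Matrix.det_one, mul_one]
        have h2 : (Matrix.of fun i j : Fin N => cheb (l j) i) =
            (Matrix.of fun i j : Fin N => cheb (j : ℤ) i).submatrix id σ := by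
          ext1 i j
          simp only [Matrix.of_apply, Matrix.submatrix_apply, id, hσ, cheb_natAbs]
        rw [h1, alternant, h2, Matrix.det_permute', groundAlt, alternant, Algebra.smul_def]
        simp
    · left
      push Not at hlt
      obtain ⟨a, ha⟩ := hlt
      constructor
      · classical
        have hcard : (Finset.univ.image fun i => (l i).natAbs).card = N := by
          rw [Finset.card_image_of_injective _ hinj, Finset.card_univ, Fintype.card_fin]
        have := sum_range_sq_lt_sum_sq (s := Finset.univ.image fun i => (l i).natAbs)
          (Finset.mem_image_of_mem _ (Finset.mem_univ a)) (by rw [hcard]; exact ha)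
        rw [hcard, Finset.sum_image fun _ _ _ _ h => hinj h, ← Fin.sum_univ_eq_sum_range
          (fun i => i ^ 2)] at this
        have h2 : ((∑ i : Fin N, (i : ℕ) ^ 2 : ℕ) : ℝ) < ((∑ i, (l i).natAbs ^ 2 : ℕ) : ℝ) :=
          Nat.cast_lt.mpr this
        simpa [Nat.cast_natAbs, sq_abs] using h2.ne'
      · exact Matrix.det_eq_zero_of_column_eq_zero a fun i => if_neg (by omega)
  · have : ∃ a b, (l a).natAbs = (l b).natAbs ∧ a ≠ b := by
      simpa [Function.Injective] using hinj
    obtain ⟨a, b, hab, hne⟩ := this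
    have h1 : altCoeff l = 0 := Matrix.det_zero_of_column_eq hne fun i => by
      simp only [Matrix.of_apply, hab]
    have h2 : alternant l = 0 := Matrix.det_zero_of_column_eq hne fun i => by
      simp only [Matrix.of_apply]
      rw [← cheb_natAbs, hab, cheb_natAbs]
    rw [h1, h2, zero_smul]
    tauto

end AlternantCoefficients

section SecondMoment

variable {N : ℕ}

theorem Matrix.det_updateCol_one {n R : Type*} [Fintype n] [DecidableEq n] [CommRing R]
    (j : n) (u : n → R) : ((1 : Matrix n n R).updateCol j u).det = u j := by
  rw [← Matrix.cramer_apply, Matrix.cramer_one]; rfl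

theorem Matrix.det_updateCol_updateCol_one {n R : Type*} [Fintype n] [DecidableEq n] [CommRing R]
    {j j' : n} (h : j ≠ j') (u v : n → R) :
    (((1 : Matrix n n R).updateCol j u).updateCol j' v).det = u j * v j' - u j' * v j := by
  let U : Matrix n (Fin 2) R := Matrix.of fun i => ![u i - (1 : Matrix n n R) i j,
    v i - (1 : Matrix n n R) i j']
  let V : Matrix (Fin 2) n R := Matrix.of ![(1 : Matrix n n R) j, (1 : Matrix n n R) j']
  have e : ((1 : Matrix n n R).updateCol j u).updateCol j' v = 1 + U * V := by
    ext i a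
    rw [Matrix.add_apply, Matrix.mul_apply, Fin.sum_univ_two, Matrix.updateCol_apply,
      Matrix.updateCol_apply]
    by_cases h1 : a = j'
    · subst h1
      simp [U, V, Matrix.one_apply, h]
    · by_cases h2 : a = j
      · subst h2
        simp [U, V, Matrix.one_apply, h1, h.symm]
      · simp [U, V, h1, h2, Ne.symm h1, Ne.symm h2]
  rw [e, Matrix.det_one_add_mul_comm, Matrix.det_fin_two]
  simp only [Matrix.add_apply, Matrix.mul_apply, Matrix.one_apply, U, V, Matrix.of_apply,
    Matrix.cons_val_zero, Matrix.cons_val_one, ite_mul, one_mul, zero_mul, Finset.sum_ite_eq,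
    Finset.mem_univ, if_true, h, h.symm, if_false]
  simp
  ring

/-- Move the entry `p.1` of `l` up or down by `k`. -/
def moveEntry (k : ℤ) (l : Fin N → ℤ) (p : Fin N × Bool) : Fin N → ℤ :=
  Function.update l p.1 (l p.1 + cond p.2 k (-k))

theorem chebSum_mul_alternant_eq_sum_moveEntry (k : ℤ) (l : Fin N → ℤ) :
    chebSum k * alternant l = ∑ p, alternant (moveEntry k l p) := by
  rw [chebSum_mul_alternant, Fintype.sum_prod_type]
  refine Finset.sum_congr rfl fun j _ => ?_
  rw [Fintype.sum_bool]
  rfl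

theorem groundAlt_mul_chebSum_sq (k : ℤ) :
    groundAlt N * chebSum k ^ 2 = ∑ x : (Fin N × Bool) × (Fin N × Bool),
      alternant (moveEntry k (moveEntry k (fun j => (j : ℤ)) x.1) x.2) := by
  rw [sq, mul_comm, mul_assoc, groundAlt, chebSum_mul_alternant_eq_sum_moveEntry, Finset.mul_sum]
  refine Eq.trans ?_ (Fintype.sum_prod_type _).symm
  refine Finset.sum_congr rfl fun p _ => ?_
  rw [chebSum_mul_alternant_eq_sum_moveEntry]

/-- The indicator column with a one at position `|a|`. -/
def absCol (a : ℤ) (i : Fin N) : ℝ := if a.natAbs = i then 1 else 0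

theorem altCoeff_moveEntry_self (k : ℤ) (j : Fin N) (s t : Bool) :
    altCoeff (moveEntry k (moveEntry k (fun j => (j : ℤ)) (j, s)) (j, t)) =
      absCol ((j : ℤ) + cond s k (-k) + cond t k (-k)) j := by
  rw [← Matrix.det_updateCol_one j (absCol _), altCoeff]
  congr 1
  ext i a
  rw [Matrix.updateCol_apply]
  by_cases h : a = j
  · simp [moveEntry, absCol, h]
  · simp [moveEntry, h, Matrix.one_apply, Fin.ext_iff, eq_comm]

theorem altCoeff_moveEntry_of_ne (k : ℤ) {j j' : Fin N} (h : j ≠ j') (s t : Bool) :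
    altCoeff (moveEntry k (moveEntry k (fun j => (j : ℤ)) (j, s)) (j', t)) =
      absCol ((j : ℤ) + cond s k (-k)) j * absCol ((j' : ℤ) + cond t k (-k)) j' -
        absCol ((j : ℤ) + cond s k (-k)) j' * absCol ((j' : ℤ) + cond t k (-k)) j := by
  rw [← Matrix.det_updateCol_updateCol_one h, altCoeff]
  congr 1
  ext i a
  rw [Matrix.updateCol_apply, Matrix.updateCol_apply]
  by_cases h1 : a = j'
  · simp [moveEntry, absCol, h1, h.symm]
  · by_cases h2 : a = j
    · simp [moveEntry, absCol, h2, h]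
    · simp [moveEntry, h1, h2, Matrix.one_apply, Fin.ext_iff, eq_comm]

theorem sum_altCoeff_moveEntry {k : ℕ} (hk : 1 ≤ k) (j j' : Fin N) :
    ∑ s, ∑ t, altCoeff (moveEntry k (moveEntry k (fun j => (j : ℤ)) (j, s)) (j', t)) =
      (if j = j' then (if (j : ℕ) = k then 3 else 2) else 0) +
      (if 2 * (j : ℕ) = k then 1 else 0) * (if 2 * (j' : ℕ) = k then 1 else 0) -
      ((if (j' : ℕ) = j + k then 1 else 0) + (if (j : ℕ) = j' + k then 1 else 0) +
        (if (j : ℕ) + j' = k then 1 else 0)) := by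
  simp only [Fintype.sum_bool]
  by_cases h : j = j'
  · subst h
    simp only [altCoeff_moveEntry_self, absCol, cond_true, cond_false]
    rw [if_neg (by omega), if_pos (by omega), if_pos (by omega)]
    have h1 : ((j : ℤ) + -(k : ℤ) + -k).natAbs = j ↔ (j : ℕ) = k := by omega
    have h2 : (j : ℕ) + j = k ↔ 2 * (j : ℕ) = k := by omega
    have h3 : ¬ (j : ℕ) = j + k := by omega
    simp only [h1, h2, h3, if_true, if_false]
    split_ifs <;> norm_num
  · simp only [altCoeff_moveEntry_of_ne _ h, absCol, cond_true, cond_false, if_neg h]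
    have h1 : ∀ a b : Fin N, (((a : ℕ) : ℤ) + k).natAbs = b ↔ (b : ℕ) = a + k := by omega
    have h2 : ∀ a : Fin N, (((a : ℕ) : ℤ) + -k).natAbs = a ↔ 2 * (a : ℕ) = k := by omega
    have h3 : ∀ a : Fin N, ¬ (a : ℕ) = a + k := by omega
    simp only [h1, h2, h3, if_false]
    have h4 : (((j : ℕ) : ℤ) + -k).natAbs = j' ↔ (j : ℕ) = j' + k ∨ (j : ℕ) + j' = k := by omega
    have h5 : (((j' : ℕ) : ℤ) + -k).natAbs = j ↔ (j' : ℕ) = j + k ∨ (j : ℕ) + j' = k := by omega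
    simp only [h4, h5]
    have h6 : ¬ ((j : ℕ) = j' + k ∧ (j' : ℕ) = j + k) := by omega
    by_cases a1 : (j : ℕ) = j' + k <;> by_cases a2 : (j' : ℕ) = j + k
    · exact absurd ⟨a1, a2⟩ h6
    · rw [if_neg a2, if_pos a1, if_pos (Or.inl a1)]
      simp only [a2, false_or]
      ring
    · rw [if_pos a2, if_neg a1, if_pos (Or.inl a2)]
      simp only [a1, false_or]
      ring
    · rw [if_neg a2, if_neg a1]
      simp only [a1, a2, false_or]
      split_ifs <;> norm_num

theorem sum_fin_ite_eq (a : ℕ) : ∑ j : Fin N, (if (j : ℕ) = a then (1 : ℝ) else 0) =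
    if a < N then 1 else 0 := by
  rw [Fin.sum_univ_eq_sum_range (fun j => if j = a then (1 : ℝ) else 0), Finset.sum_ite_eq']
  simp only [Finset.mem_range]

theorem sum_fin_ite_mem_Ico {a b : ℕ} (hb : b ≤ N) :
    ∑ j : Fin N, (if a ≤ (j : ℕ) ∧ (j : ℕ) < b then (1 : ℝ) else 0) = ((b - a : ℕ) : ℝ) := by
  rw [Fin.sum_univ_eq_sum_range (fun j => if a ≤ j ∧ j < b then (1 : ℝ) else 0), Finset.sum_boole,
    ← Nat.card_Ico]
  congr 2
  ext j
  simp only [Finset.mem_filter, Finset.mem_range, Finset.mem_Ico]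
  omega

theorem sum_altCoeff_moveEntry_eq {k : ℕ} (hk : 1 ≤ k) (hN : 1 ≤ N) :
    ∑ x : (Fin N × Bool) × (Fin N × Bool),
      altCoeff (moveEntry (k : ℤ) (moveEntry k (fun j => (j : ℤ)) x.1) x.2) =
      min (k : ℝ) (2 * N) + eta N k := by
  have h0 : ∑ x : (Fin N × Bool) × (Fin N × Bool),
      altCoeff (moveEntry (k : ℤ) (moveEntry k (fun j => (j : ℤ)) x.1) x.2) =
      ∑ j : Fin N, ∑ j' : Fin N, ∑ s : Bool, ∑ t : Bool,
        altCoeff (moveEntry (k : ℤ) (moveEntry k (fun j => (j : ℤ)) (j, s)) (j', t)) := by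
    simp only [Fintype.sum_prod_type]
    exact Finset.sum_congr rfl fun j _ => Finset.sum_comm
  have h1 : ∑ j : Fin N, (if (j : ℕ) = k then (3 : ℝ) else 2) =
      2 * N + if k < N then 1 else 0 := by
    have h : (2 * N : ℝ) = ∑ _j : Fin N, (2 : ℝ) := by simp [mul_comm]
    rw [← sum_fin_ite_eq, h, ← Finset.sum_add_distrib]
    exact Finset.sum_congr rfl fun j _ => by split_ifs <;> norm_num
  have h2 : ∑ j : Fin N, (if 2 * (j : ℕ) = k then (1 : ℝ) else 0) = eps N k := by
    by_cases he : Even k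
    · obtain ⟨a, rfl⟩ := he
      have : ∀ j : Fin N, 2 * (j : ℕ) = a + a ↔ (j : ℕ) = a := by omega
      simp only [this]
      rw [sum_fin_ite_eq, eps]
      refine if_congr ?_ rfl rfl
      simp only [Even.add_self, true_and]
      omega
    · rw [eps, if_neg fun h => he h.1]
      exact Finset.sum_eq_zero fun j _ => if_neg fun h => he ⟨j, by omega⟩
  have h3 : ∀ j : Fin N, ∑ j' : Fin N, (if (j' : ℕ) = j + k then (1 : ℝ) else 0) =
      if 0 ≤ (j : ℕ) ∧ (j : ℕ) < N - k then 1 else 0 := fun j => by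
    rw [sum_fin_ite_eq]
    exact if_congr (by omega) rfl rfl
  have h4 : ∀ j : Fin N, ∑ j' : Fin N, (if (j : ℕ) + j' = k then (1 : ℝ) else 0) =
      if k + 1 - N ≤ (j : ℕ) ∧ (j : ℕ) < min N (k + 1) then 1 else 0 := fun j => by
    by_cases hj : (j : ℕ) ≤ k
    · have : ∀ j' : Fin N, (j : ℕ) + j' = k ↔ (j' : ℕ) = k - j := by omega
      simp only [this]
      rw [sum_fin_ite_eq]
      exact if_congr (by omega) rfl rfl
    · rw [if_neg (by omega)]
      exact Finset.sum_eq_zero fun j' _ => if_neg (by omega)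
  rw [h0]
  simp only [sum_altCoeff_moveEntry hk, Finset.sum_sub_distrib, Finset.sum_add_distrib,
    Finset.sum_ite_eq, Finset.mem_univ, if_true]
  rw [h1, ← Finset.sum_mul_sum, h2,
    Finset.sum_comm (f := fun j j' : Fin N => if (j : ℕ) = j' + k then (1 : ℝ) else 0)]
  simp only [h3, h4]
  rw [sum_fin_ite_mem_Ico (Nat.sub_le _ _), sum_fin_ite_mem_Ico (min_le_left _ _), eta]
  have h5 : eps N k * eps N k = eps N k := by rw [eps]; split_ifs <;> norm_num
  rw [h5]
  rcases lt_or_ge k N with h | h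
  · rw [if_pos h, if_pos (by omega), if_pos (by omega), min_eq_right (a := N) (by omega),
      show k + 1 - N = 0 by omega, Nat.sub_zero, Nat.sub_zero, min_eq_left (by norm_cast; omega)]
    push_cast [h.le]
    ring
  · rw [if_neg (by omega), if_neg (by omega : ¬ k ≤ N - 1), Nat.sub_eq_zero_of_le h, Nat.zero_sub,
      min_eq_left (a := N) (by omega)]
    rcases lt_or_ge k (2 * N) with h' | h'
    · rw [if_pos (by omega), min_eq_left (by norm_cast; omega)]
      have : ((N - (k + 1 - N) : ℕ) : ℝ) = 2 * N - (k + 1) := by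
        rw [Nat.cast_sub (by omega), Nat.cast_sub (by omega)]
        push_cast
        ring
      rw [this]
      push_cast
      ring
    · rw [if_neg (by omega), show N - (k + 1 - N) = 0 by omega, min_eq_right (by norm_cast)]
      push_cast
      ring

/-- A normalised functional satisfying the Schwinger–Dyson equations gives `chebSum k ^ 2` its
second moment under the Haar measure of `SO(2N)`. -/
theorem expectation_chebSum_sq (E : MvPolynomial (Fin N) ℝ →ₗ[ℝ] ℝ) (hE1 : E 1 = 1)
    (hE : ∀ k : ℕ, ∀ g ∈ traceAlgebra N,
      E (g * ((k : MvPolynomial (Fin N) ℝ) * drift k) + gam (chebSum (k : ℤ)) g) = 0)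
    (hN : 1 ≤ N) {k : ℕ} (hk : 1 ≤ k) :
    E (chebSum (k : ℤ) ^ 2) = min (k : ℝ) (2 * N) + eta N k := by
  have := expectation_eq_sum_of_eigen E hE1 hE (α := (Fin N × Bool) × (Fin N × Bool)) Finset.univ
    (fun x => ∑ i, (moveEntry (k : ℤ) (moveEntry k (fun j : Fin N => (j : ℤ)) x.1) x.2 i : ℝ) ^ 2)
    (∑ i : Fin N, (((i : ℕ) : ℤ) : ℝ) ^ 2) ?_
    (fun x => alternant (moveEntry (k : ℤ) (moveEntry k (fun j : Fin N => (j : ℤ)) x.1) x.2))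
    (fun x => altCoeff (moveEntry (k : ℤ) (moveEntry k (fun j : Fin N => (j : ℤ)) x.1) x.2))
    (fun x _ => ?_) (fun x _ => ?_) (chebSum (k : ℤ) ^ 2)
    (Subalgebra.pow_mem _ (chebSum_mem_traceAlgebra _) 2) (groundAlt_mul_chebSum_sq _)
  · exact this.trans (sum_altCoeff_moveEntry_eq hk hN)
  · exact flatLap_alternant _
  · exact flatLap_alternant _
  · exact alternant_dichotomy _

end SecondMoment

section EigenvaluePairs

open Polynomial

theorem aeval_chebyshev_C_add {R A : Type*} [CommRing R] [Ring A] [Algebra R A] {a b : A}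
    (hab : a * b = 1) (hba : b * a = 1) (k : ℕ) :
    aeval (a + b) (Chebyshev.C R k) = a ^ k + b ^ k := by
  induction k using Nat.twoStepInduction with
  | zero =>
    rw [Nat.cast_zero, Chebyshev.C_zero, map_ofNat, pow_zero, pow_zero, one_add_one_eq_two]
  | one => simp
  | more k h1 h2 =>
    have e : ((k + 2 : ℕ) : ℤ) = (k : ℤ) + 2 := by push_cast; ring
    have e' : ((k + 1 : ℕ) : ℤ) = (k : ℤ) + 1 := by push_cast; ring
    rw [e'] at h2
    rw [e, Chebyshev.C_add_two, map_sub, map_mul, aeval_X, h1, h2, add_mul, mul_add, mul_add,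
      ← pow_succ', ← pow_succ', pow_succ' b k, ← mul_assoc, hab, one_mul, pow_succ' a k,
      ← mul_assoc, hba, one_mul]
    abel

theorem exists_eval_add_inv_of_reverse_eq {p : ℝ[X]} {N : ℕ} (hdeg : p.natDegree = 2 * N)
    (hrev : p.reverse = p) :
    ∃ q : ℝ[X], ∀ z : ℝ, z ≠ 0 → p.eval z = z ^ N * q.eval (z + z⁻¹) := by
  have hsymm : ∀ i ≤ 2 * N, p.coeff (2 * N - i) = p.coeff i := fun i hi => by
    conv_rhs => rw [← hrev, coeff_reverse, hdeg, revAt_le hi]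
  refine ⟨C (p.coeff N) + ∑ j ∈ Finset.range N,
    C (p.coeff (N + (j + 1))) * Chebyshev.C ℝ ((j + 1 : ℕ) : ℤ), fun z hz => ?_⟩
  have hC : ∀ k : ℕ, (Chebyshev.C ℝ (k : ℤ)).eval (z + z⁻¹) = z ^ k + z⁻¹ ^ k := fun k => by
    rw [← aeval_chebyshev_C_add (R := ℝ) (mul_inv_cancel₀ hz) (inv_mul_cancel₀ hz) k,
      coe_aeval_eq_eval]
  rw [eval_eq_sum_range, hdeg, show 2 * N + 1 = N + (N + 1) by ring, Finset.sum_range_add,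
    Finset.sum_range_succ', ← Finset.sum_range_reflect, eval_add, eval_C, eval_finsetSum]
  simp only [eval_mul, eval_C, hC, add_zero]
  rw [mul_add, Finset.mul_sum, add_comm (z ^ N * p.coeff N), mul_comm (z ^ N) (p.coeff N),
    ← add_assoc, ← Finset.sum_add_distrib]
  congr 1
  refine Finset.sum_congr rfl fun j hj => ?_
  have hj := Finset.mem_range.mp hj
  rw [← hsymm (N + (j + 1)) (by omega), show 2 * N - (N + (j + 1)) = N - 1 - j by omega]
  have e : z ^ N = z ^ (N - 1 - j) * z ^ (j + 1) := by rw [← pow_add]; congr 1; omega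
  rw [pow_add, e]
  have e2 : z ^ (j + 1) * z⁻¹ ^ (j + 1) = 1 := by rw [← mul_pow, mul_inv_cancel₀ hz, one_pow]
  linear_combination (-p.coeff (N - 1 - j) * z ^ (N - 1 - j)) * e2

variable {n : Type*} [Fintype n] [DecidableEq n]

theorem Matrix.IsHermitian.trace_aeval {S : Matrix n n ℝ} (hS : S.IsHermitian) (q : ℝ[X]) :
    (aeval S q).trace = ∑ i, q.eval (hS.eigenvalues i) := by
  have h : ∀ k : ℕ, (S ^ k).trace = ∑ i, hS.eigenvalues i ^ k := fun k => by
    conv_lhs => rw [hS.spectral_theorem]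
    rw [← map_pow, Unitary.conjStarAlgAut_apply, Matrix.trace_mul_cycle, Unitary.coe_star_mul_self,
      one_mul, Matrix.diagonal_pow, Matrix.trace_diagonal]
    rfl
  simp only [aeval_eq_sum_range, eval_eq_sum_range, Matrix.trace_sum, Matrix.trace_smul, h,
    smul_eq_mul]
  rw [Finset.sum_comm]
  exact Finset.sum_congr rfl fun _ _ => Finset.mul_sum _ _ _

theorem Matrix.reverse_charpoly_of_orthogonal {A : Matrix n n ℝ} (hA : A * Aᵀ = 1)
    (hdet : A.det = 1) (hn : Even (Fintype.card n)) : A.charpoly.reverse = A.charpoly := by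
  have hA' : A⁻¹ = Aᵀ := Matrix.inv_eq_right_inv hA
  have := Matrix.charpoly_inv A (IsUnit.of_mul_eq_one _ hA)
  rw [hA', Matrix.charpoly_transpose, hdet, hn.neg_one_pow, one_mul, Ring.inverse_one, map_one,
    one_mul] at this
  rw [Matrix.reverse_charpoly, ← this]

theorem Matrix.eval_charpoly_add_transpose {A : Matrix n n ℝ} (hA : A * Aᵀ = 1) {z : ℝ}
    (hz : z ≠ 0) :
    z ^ Fintype.card n * (A + Aᵀ).charpoly.eval (z + z⁻¹) = A.charpoly.eval z ^ 2 := by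
  have e : (z • (1 : Matrix n n ℝ)) * ((z + z⁻¹) • 1 - (A + Aᵀ)) =
      (z • 1 - A) * (z • 1 - A)ᵀ := by
    simp only [Matrix.transpose_sub, Matrix.transpose_smul, Matrix.transpose_one, sub_mul, mul_sub,
      smul_mul_assoc, mul_smul_comm, one_mul, mul_one, hA, smul_sub, smul_smul, mul_add,
      inv_mul_cancel₀ hz, add_smul, one_smul]
    abel
  have := congrArg Matrix.det e
  rw [Matrix.det_mul, Matrix.det_mul, Matrix.det_transpose, Matrix.det_smul, Matrix.det_one,
    mul_one, ← sq] at this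
  rw [Matrix.eval_charpoly, Matrix.eval_charpoly]
  simpa only [Matrix.smul_one_eq_diagonal, Matrix.scalar_apply] using this

/-- The eigenvalues of `A + Aᵀ` come in pairs for `A` special orthogonal of even size. -/
theorem exists_trace_aeval_add_transpose {N : ℕ} {A : Matrix n n ℝ} (hA : A * Aᵀ = 1)
    (hdet : A.det = 1) (hn : Fintype.card n = 2 * N) :
    ∃ c : Fin N → ℝ, ∀ q : ℝ[X], (aeval (A + Aᵀ) q).trace = 2 * ∑ j, q.eval (c j) := by
  obtain ⟨Q, hQ⟩ := exists_eval_add_inv_of_reverse_eq (N := N) (by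
    rw [Matrix.charpoly_natDegree_eq_dim, hn]) (Matrix.reverse_charpoly_of_orthogonal hA hdet
      (hn ▸ even_two_mul N))
  have hsq : (A + Aᵀ).charpoly = Q ^ 2 := by
    refine eq_of_infinite_eval_eq _ _ ((Set.Ici_infinite (2 : ℝ)).mono fun x hx => ?_)
    have hx : 2 ≤ x := hx
    set s := Real.sqrt (x ^ 2 - 4) with hs
    have hs2 : s ^ 2 = x ^ 2 - 4 := Real.sq_sqrt (by nlinarith)
    have hs0 : 0 ≤ s := Real.sqrt_nonneg _
    have hz : (x + s) / 2 ≠ 0 := by positivity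
    have hzx : (x + s) / 2 + ((x + s) / 2)⁻¹ = x := by
      field_simp
      nlinarith
    have h1 := Matrix.eval_charpoly_add_transpose hA hz
    rw [hQ _ hz, hzx, hn, mul_pow, ← pow_mul, mul_comm N 2] at h1
    simpa using mul_left_cancel₀ (pow_ne_zero _ hz) h1
  have hS : (A + Aᵀ).IsHermitian := by
    rw [Matrix.IsHermitian, Matrix.conjTranspose_eq_transpose_of_trivial, Matrix.transpose_add,
      Matrix.transpose_transpose, add_comm]
  have hroots := hS.roots_charpoly_eq_eigenvalues
  rw [hsq, roots_pow] at hroots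
  have hcard : Q.roots.card = N := by
    have := congrArg Multiset.card hroots
    rw [Multiset.card_nsmul, Multiset.card_map, Finset.card_val, Finset.card_univ, hn] at this
    omega
  refine ⟨fun j => Q.roots.toList.get (j.cast (by rw [Multiset.length_toList, hcard])), fun q => ?_⟩
  rw [hS.trace_aeval]
  have h1 : ∑ i, q.eval (hS.eigenvalues i) = ((Q.roots.map fun x => q.eval x).sum) * 2 := by
    have := congrArg (fun s => (s.map fun x => q.eval x).sum) hroots
    simp only [Multiset.map_nsmul, Multiset.sum_nsmul, Multiset.map_map] at this
    rw [mul_comm, two_mul, ← two_nsmul, this]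
    rfl
  rw [h1, mul_comm]
  congr 1
  have h2 : (Q.roots.map fun x => q.eval x).sum = (Q.roots.toList.map fun x => q.eval x).sum := by
    rw [← Multiset.sum_coe, ← Multiset.map_coe, Multiset.coe_toList]
  rw [h2, ← List.sum_ofFn]
  congr 1
  refine List.ext_get (by simp [hcard]) fun i h1 h2 => by simp

end EigenvaluePairs

section Rotations

variable {n : Type*} [DecidableEq n]

/-- The infinitesimal rotation in the coordinate plane `(i, j)`. -/
def rotGen (i j : n) : Matrix n n ℝ := Matrix.single i j 1 - Matrix.single j i 1

theorem rotGen_transpose (i j : n) : (rotGen i j)ᵀ = -rotGen i j := by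
  simp [rotGen, Matrix.transpose_sub]

variable [Fintype n]

/-- The rotation by angle `t` in the coordinate plane `(i, j)`. -/
def rot (i j : n) (t : ℝ) : Matrix n n ℝ :=
  1 + Real.sin t • rotGen i j + (1 - Real.cos t) • (rotGen i j * rotGen i j)

theorem rotGen_mul_rotGen_mul_rotGen (i j : n) :
    rotGen i j * rotGen i j * rotGen i j = -rotGen i j := by
  by_cases h : i = j
  · simp [rotGen, h]
  · simp [rotGen, sub_mul, mul_sub, Matrix.single_mul_single_of_ne, h, Ne.symm h]
    abel

theorem rot_zero (i j : n) : rot i j 0 = 1 := by simp [rot]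

theorem rot_mul_rot (i j : n) (s t : ℝ) : rot i j s * rot i j t = rot i j (s + t) := by
  have h3 := rotGen_mul_rotGen_mul_rotGen i j
  simp only [rot, Real.sin_add, Real.cos_add]
  set X := rotGen i j
  have h3' : X * (X * X) = -X := by rw [← mul_assoc, h3]
  have h4 : X * X * (X * X) = -(X * X) := by rw [← mul_assoc, h3, neg_mul]
  simp only [add_mul, mul_add, one_mul, mul_one, smul_mul_assoc, mul_smul_comm, h3, h3', h4]
  module

theorem rot_transpose (i j : n) (t : ℝ) : (rot i j t)ᵀ = rot i j (-t) := by
  simp [rot, Matrix.transpose_add, Matrix.transpose_smul, Matrix.transpose_mul, rotGen_transpose]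

theorem rot_mem_specialOrthogonalGroup (i j : n) (t : ℝ) :
    rot i j t ∈ Matrix.specialOrthogonalGroup n ℝ := by
  have h : ∀ t, rot i j t * (rot i j t)ᵀ = 1 := fun t => by
    rw [rot_transpose, rot_mul_rot, add_neg_cancel, rot_zero]
  refine Matrix.mem_specialOrthogonalGroup_iff.mpr
    ⟨(Matrix.mem_orthogonalGroup_iff _ _).mpr (h t), ?_⟩
  have h2 := congrArg Matrix.det (h (t / 2))
  rw [Matrix.det_mul, Matrix.det_transpose, Matrix.det_one] at h2
  rw [← add_halves t, ← rot_mul_rot, Matrix.det_mul, h2]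

theorem hasDerivAt_rot_apply (i j a b : n) :
    HasDerivAt (fun t => rot i j t a b) (rotGen i j a b) 0 := by
  have h := (((Real.hasDerivAt_sin 0).mul_const (rotGen i j a b)).const_add
    ((1 : Matrix n n ℝ) a b)).fun_add (((Real.hasDerivAt_cos 0).const_sub 1).mul_const
      ((rotGen i j * rotGen i j) a b))
  simpa [rot] using h

theorem trace_rotGen_mul (i j : n) (B : Matrix n n ℝ) :
    (rotGen i j * B).trace = B j i - B i j := by
  simp [rotGen, sub_mul, Matrix.trace_sub, Matrix.trace_single_mul]

theorem sum_trace_rotGen_mul_mul_trace_rotGen_mul (B C : Matrix n n ℝ) :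
    ∑ i, ∑ j, (rotGen i j * B).trace * (rotGen i j * C).trace =
      2 * ((Bᵀ * C).trace - (B * C).trace) := by
  have h1 : (Bᵀ * C).trace = ∑ i, ∑ j, B j i * C j i := by simp [Matrix.trace, Matrix.mul_apply]
  have h2 : (B * C).trace = ∑ i, ∑ j, B i j * C j i := by simp [Matrix.trace, Matrix.mul_apply]
  have h3 : ∑ i, ∑ j, B j i * C j i = ∑ i, ∑ j, B i j * C i j := Finset.sum_comm
  have h4 : ∑ i, ∑ j, B i j * C j i = ∑ i, ∑ j, B j i * C i j := Finset.sum_comm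
  have h5 : ∑ i, ∑ j, (rotGen i j * B).trace * (rotGen i j * C).trace =
      ∑ i, ∑ j, B j i * C j i - ∑ i, ∑ j, B j i * C i j - ∑ i, ∑ j, B i j * C j i
        + ∑ i, ∑ j, B i j * C i j := by
    simp only [← Finset.sum_sub_distrib, ← Finset.sum_add_distrib, trace_rotGen_mul]
    exact Finset.sum_congr rfl fun i _ => Finset.sum_congr rfl fun j _ => by ring
  rw [h5, h1, h2, ← h3, ← h4]
  ring

theorem sum_trace_rotGen_mul_rotGen_mul (B C : Matrix n n ℝ) :
    ∑ i, ∑ j, (rotGen i j * B * (rotGen i j * C)).trace =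
      2 * ((Bᵀ * C).trace - B.trace * C.trace) := by
  have h0 : ∀ i j : n, (rotGen i j * B * (rotGen i j * C)).trace =
      B j i * C j i - B j j * C i i - B i i * C j j + B i j * C i j := fun i j => by
    rw [mul_assoc, trace_rotGen_mul]
    simp [rotGen, sub_mul, mul_sub, Matrix.mul_apply, Matrix.single, ite_and,
      Finset.sum_sub_distrib]
    ring
  have h1 : (Bᵀ * C).trace = ∑ i, ∑ j, B j i * C j i := by simp [Matrix.trace, Matrix.mul_apply]
  have h2 : B.trace * C.trace = ∑ i, ∑ j, B i i * C j j := by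
    rw [Matrix.trace, Matrix.trace, Finset.sum_mul_sum]; rfl
  have h3 : ∑ i, ∑ j, B j i * C j i = ∑ i, ∑ j, B i j * C i j := Finset.sum_comm
  have h4 : ∑ i, ∑ j, B i i * C j j = ∑ i, ∑ j, B j j * C i i := Finset.sum_comm
  simp only [h0, Finset.sum_add_distrib, Finset.sum_sub_distrib]
  rw [h1, h2, ← h3, ← h4]
  ring

/-- `F'` is the derivative of `F` along the right invariant vector field of `rotGen i j`. -/
def HasRotDeriv (i j : n) (F F' : Matrix n n ℝ → ℝ) : Prop :=
  ∀ A, HasDerivAt (fun t => F (rot i j t * A)) (F' A) 0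

theorem HasRotDeriv.hasDerivAt {i j : n} {F F' : Matrix n n ℝ → ℝ} (h : HasRotDeriv i j F F')
    (A : Matrix n n ℝ) (t : ℝ) :
    HasDerivAt (fun t => F (rot i j t * A)) (F' (rot i j t * A)) t := by
  have h1 := h (rot i j t * A)
  rw [← sub_self t] at h1
  have h2 := h1.comp_sub_const t t
  simpa only [← mul_assoc, rot_mul_rot, sub_add_cancel] using h2

theorem hasRotDeriv_pow_apply (i j : n) (k : ℕ) (a b : n) :
    HasRotDeriv i j (fun A => (A ^ k) a b)
      fun A => (∑ m ∈ Finset.range k, A ^ m * (rotGen i j * A ^ (k - m))) a b := by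
  intro A
  have h1 : ∀ a b, HasDerivAt (fun t => (rot i j t * A) a b) ((rotGen i j * A) a b) 0 :=
    fun a b => by
      simp only [Matrix.mul_apply]
      exact HasDerivAt.fun_sum fun c _ => (hasDerivAt_rot_apply i j a c).mul_const _
  induction k generalizing a b with
  | zero => simpa using hasDerivAt_const (0 : ℝ) _
  | succ k ih =>
    have h2 : HasDerivAt (fun t => ((rot i j t * A) ^ (k + 1)) a b)
        (∑ c, ((∑ m ∈ Finset.range k, A ^ m * (rotGen i j * A ^ (k - m))) a c * A c b +
          (A ^ k) a c * (rotGen i j * A) c b)) 0 := by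
      simp only [pow_succ, Matrix.mul_apply (M := (_ : Matrix n n ℝ) ^ k)]
      refine HasDerivAt.fun_sum fun c _ => ?_
      have := (ih a c).fun_mul (h1 c b)
      simpa [rot_zero] using this
    have h3 : ∑ m ∈ Finset.range (k + 1), A ^ m * (rotGen i j * A ^ (k + 1 - m)) =
        (∑ m ∈ Finset.range k, A ^ m * (rotGen i j * A ^ (k - m))) * A +
          A ^ k * (rotGen i j * A) := by
      rw [Finset.sum_range_succ, Finset.sum_mul, Nat.add_sub_cancel_left, pow_one]
      congr 1
      refine Finset.sum_congr rfl fun m hm => ?_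
      rw [mul_assoc, mul_assoc, ← pow_succ, Nat.sub_add_comm (Finset.mem_range.mp hm).le]
    beta_reduce
    rw [h3]
    rw [Finset.sum_add_distrib] at h2
    exact h2

theorem HasRotDeriv.fun_mul {i j : n} {F F' G G' : Matrix n n ℝ → ℝ} (hF : HasRotDeriv i j F F')
    (hG : HasRotDeriv i j G G') :
    HasRotDeriv i j (fun A => F A * G A) fun A => F' A * G A + F A * G' A := fun A => by
  have h := (hF A).fun_mul (hG A)
  simpa only [rot_zero, one_mul] using h

theorem HasRotDeriv.fun_add {i j : n} {F F' G G' : Matrix n n ℝ → ℝ} (hF : HasRotDeriv i j F F')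
    (hG : HasRotDeriv i j G G') :
    HasRotDeriv i j (fun A => F A + G A) fun A => F' A + G' A := fun A =>
  (hF A).fun_add (hG A)

theorem hasRotDeriv_const (i j : n) (c : ℝ) : HasRotDeriv i j (fun _ => c) fun _ => 0 := fun _ =>
  hasDerivAt_const _ _

theorem hasRotDeriv_trace_mul_pow (i j : n) (B : Matrix n n ℝ) (k : ℕ) :
    HasRotDeriv i j (fun A => (B * A ^ k).trace)
      fun A => ∑ m ∈ Finset.range k, (B * A ^ m * (rotGen i j * A ^ (k - m))).trace := by
  intro A
  have h : HasDerivAt (fun t => ∑ a, ∑ b, B a b * ((rot i j t * A) ^ k) b a)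
      (∑ a, ∑ b, B a b *
        (∑ m ∈ Finset.range k, A ^ m * (rotGen i j * A ^ (k - m))) b a) 0 :=
    HasDerivAt.fun_sum fun a _ => HasDerivAt.fun_sum fun b _ =>
      (hasRotDeriv_pow_apply i j k b a A).const_mul _
  have h2 : ∑ m ∈ Finset.range k, (B * A ^ m * (rotGen i j * A ^ (k - m))).trace =
      (B * ∑ m ∈ Finset.range k, A ^ m * (rotGen i j * A ^ (k - m))).trace := by
    simp only [Finset.mul_sum, Matrix.trace_sum, mul_assoc]
  beta_reduce
  rw [h2]
  exact h

theorem hasRotDeriv_trace_pow (i j : n) (k : ℕ) :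
    HasRotDeriv i j (fun A => (A ^ k).trace) fun A => k * (rotGen i j * A ^ k).trace := by
  intro A
  have h := hasRotDeriv_trace_mul_pow i j 1 k A
  simp only [one_mul] at h
  convert h using 1
  rw [Finset.sum_congr rfl fun m hm => by
    rw [Matrix.trace_mul_comm, mul_assoc, ← pow_add,
      Nat.sub_add_cancel (Finset.mem_range.mp hm).le]]
  simp

end Rotations

section Integration

variable {n : Type*} [Fintype n]

instance borelSpace_matrix : BorelSpace (Matrix n n ℝ) :=
  inferInstanceAs (BorelSpace (n → n → ℝ))

variable [DecidableEq n]

theorem isCompact_specialOrthogonalGroup :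
    IsCompact {A : Matrix n n ℝ | A ∈ Matrix.specialOrthogonalGroup n ℝ} := by
  have hK : IsCompact (Set.pi Set.univ fun _ : n => Set.pi Set.univ fun _ : n =>
      Set.Icc (-1 : ℝ) 1) := isCompact_univ_pi fun _ => isCompact_univ_pi fun _ => isCompact_Icc
  have h0 : {A : Matrix n n ℝ | A ∈ Matrix.specialOrthogonalGroup n ℝ} =
      {A | A * Aᵀ = 1} ∩ {A | A.det = 1} := by
    ext A
    simp [Matrix.mem_specialOrthogonalGroup_iff, Matrix.mem_orthogonalGroup_iff]
  refine hK.of_isClosed_subset ?_ fun A hA a _ b _ => ?_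
  · rw [h0]
    exact (isClosed_eq (by fun_prop) continuous_const).inter
      (isClosed_eq (by fun_prop) continuous_const)
  · have := entry_norm_bound_of_unitary (𝕜 := ℝ) hA.1 a b
    exact abs_le.mp this

variable {μ : Measure (Matrix n n ℝ)} [IsProbabilityMeasure μ]

theorem ae_mem_specialOrthogonalGroup (hsupp : μ {A | A ∈ Matrix.specialOrthogonalGroup n ℝ} = 1) :
    ∀ᵐ A ∂μ, A ∈ Matrix.specialOrthogonalGroup n ℝ :=
  (mem_ae_iff_prob_eq_one isCompact_specialOrthogonalGroup.isClosed.measurableSet).mpr hsupp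

theorem integrable_of_continuous_of_specialOrthogonalGroup
    (hsupp : μ {A | A ∈ Matrix.specialOrthogonalGroup n ℝ} = 1)
    {F : Matrix n n ℝ → ℝ} (hF : Continuous F) : Integrable F μ := by
  obtain ⟨C, hC⟩ := isCompact_specialOrthogonalGroup.exists_bound_of_continuousOn hF.continuousOn
  exact Integrable.of_bound hF.aestronglyMeasurable C
    ((ae_mem_specialOrthogonalGroup hsupp).mono hC)

theorem HasRotDeriv.integral_eq_zero
    (hsupp : μ {A | A ∈ Matrix.specialOrthogonalGroup n ℝ} = 1)
    (hinv : ∀ g ∈ Matrix.specialOrthogonalGroup n ℝ, μ.map (fun A => g * A) = μ)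
    {i j : n} {F F' : Matrix n n ℝ → ℝ} (h : HasRotDeriv i j F F') (hF : Continuous F)
    (hF' : Continuous F') : ∫ A, F' A ∂μ = 0 := by
  obtain ⟨C, hC⟩ := isCompact_specialOrthogonalGroup.exists_bound_of_continuousOn hF'.continuousOn
  have hcont : ∀ t, Continuous fun A : Matrix n n ℝ => rot i j t * A := fun t => by fun_prop
  have h1 : ∀ t, ∫ A, F (rot i j t * A) ∂μ = ∫ A, F A ∂μ := fun t => by
    conv_rhs => rw [← hinv _ (rot_mem_specialOrthogonalGroup i j t)]
    rw [integral_map (hcont t).aemeasurable hF.aestronglyMeasurable]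
  have h2 := (hasDerivAt_integral_of_dominated_loc_of_deriv_le (μ := μ) (x₀ := (0 : ℝ))
    (F := fun t A => F (rot i j t * A)) (F' := fun t A => F' (rot i j t * A))
    (bound := fun _ => C) Filter.univ_mem
    (Filter.Eventually.of_forall fun t => (hF.comp (hcont t)).aestronglyMeasurable)
    (integrable_of_continuous_of_specialOrthogonalGroup hsupp (hF.comp (hcont 0)))
    (hF'.comp (hcont 0)).aestronglyMeasurable
    ((ae_mem_specialOrthogonalGroup hsupp).mono fun A hA t _ =>
      hC _ (mul_mem (rot_mem_specialOrthogonalGroup i j t) hA))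
    (integrable_const C)
    (Filter.Eventually.of_forall fun A t _ => h.hasDerivAt A t)).2
  simp only [h1, rot_zero, one_mul] at h2
  exact h2.unique (hasDerivAt_const _ _)

end Integration

section SchwingerDyson

variable {n : Type*} [Fintype n] [DecidableEq n] {N : ℕ}

theorem exists_eval_chebSum_eq_trace_pow (hn : Fintype.card n = 2 * N) :
    ∃ c : Matrix n n ℝ → Fin N → ℝ, ∀ A ∈ Matrix.specialOrthogonalGroup n ℝ, ∀ k : ℕ,
      MvPolynomial.eval (c A) (chebSum (k : ℤ)) = (A ^ k).trace := by
  have h : ∀ A : Matrix n n ℝ, ∃ c : Fin N → ℝ, A ∈ Matrix.specialOrthogonalGroup n ℝ → ∀ k : ℕ,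
      MvPolynomial.eval c (chebSum (k : ℤ)) = (A ^ k).trace := by
    intro A
    by_cases hA : A ∈ Matrix.specialOrthogonalGroup n ℝ
    · have h1 : A * Aᵀ = 1 := (Matrix.mem_orthogonalGroup_iff _ _).mp hA.1
      have h2 : Aᵀ * A = 1 := (Matrix.mem_orthogonalGroup_iff' _ _).mp hA.1
      obtain ⟨c, hc⟩ := exists_trace_aeval_add_transpose h1 hA.2 hn
      refine ⟨c, fun _ k => ?_⟩
      have h3 := hc (Polynomial.Chebyshev.C ℝ k)
      rw [aeval_chebyshev_C_add h1 h2, Matrix.trace_add, ← Matrix.transpose_pow,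
        Matrix.trace_transpose] at h3
      have h4 : MvPolynomial.eval c (chebSum (k : ℤ)) =
          ∑ j, (Polynomial.Chebyshev.C ℝ k).eval (c j) := by
        simp only [chebSum, cheb, map_sum]
        refine Finset.sum_congr rfl fun j _ => ?_
        rw [← MvPolynomial.coe_aeval_eq_eval, RingHom.coe_coe, ← Polynomial.aeval_algHom_apply,
          MvPolynomial.aeval_X, Polynomial.coe_aeval_eq_eval]
      linarith
    · exact ⟨0, fun h => absurd h hA⟩
  choose c hc using h
  exact ⟨c, hc⟩

variable {c : Matrix n n ℝ → Fin N → ℝ}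

theorem eval_chebSum_sub_eq_trace (hc : ∀ A ∈ Matrix.specialOrthogonalGroup n ℝ, ∀ k : ℕ,
      MvPolynomial.eval (c A) (chebSum (k : ℤ)) = (A ^ k).trace)
    {A : Matrix n n ℝ} (hA : A ∈ Matrix.specialOrthogonalGroup n ℝ) (l m : ℕ) :
    MvPolynomial.eval (c A) (chebSum ((l : ℤ) - m)) = ((A ^ m)ᵀ * A ^ l).trace := by
  have h1 : ∀ k : ℕ, (A ^ k)ᵀ * A ^ k = 1 := fun k =>
    (Matrix.mem_orthogonalGroup_iff' _ _).mp (pow_mem hA.1 k)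
  rcases Nat.le_total m l with h | h <;> obtain ⟨d, rfl⟩ := Nat.exists_eq_add_of_le h
  · rw [pow_add, ← mul_assoc, h1, one_mul, ← hc A hA]
    push_cast
    rw [add_sub_cancel_left]
  · rw [pow_add, Matrix.transpose_mul, mul_assoc, h1, mul_one, Matrix.trace_transpose, ← hc A hA,
      ← chebSum_neg]
    push_cast
    congr 2
    ring

theorem eval_drift (hc : ∀ A ∈ Matrix.specialOrthogonalGroup n ℝ, ∀ k : ℕ,
      MvPolynomial.eval (c A) (chebSum (k : ℤ)) = (A ^ k).trace)
    {A : Matrix n n ℝ} (hA : A ∈ Matrix.specialOrthogonalGroup n ℝ) (k : ℕ) :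
    ∑ i, ∑ j, ∑ m ∈ Finset.range k, (rotGen i j * A ^ m * (rotGen i j * A ^ (k - m))).trace =
      2 * MvPolynomial.eval (c A) (drift k) := by
  have h1 : ∀ i : n, ∑ j, ∑ m ∈ Finset.range k,
      (rotGen i j * A ^ m * (rotGen i j * A ^ (k - m))).trace = ∑ m ∈ Finset.range k,
      ∑ j, (rotGen i j * A ^ m * (rotGen i j * A ^ (k - m))).trace := fun i => Finset.sum_comm
  rw [Finset.sum_congr rfl fun i _ => h1 i, Finset.sum_comm, drift, map_sum, Finset.mul_sum]
  refine Finset.sum_congr rfl fun m hm => ?_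
  have hmk : ((k - m : ℕ) : ℤ) = (k : ℤ) - m := Nat.cast_sub (Finset.mem_range.mp hm).le
  rw [sum_trace_rotGen_mul_rotGen_mul, ← eval_chebSum_sub_eq_trace hc hA, ← hc A hA, ← hc A hA,
    hmk, map_sub, map_mul, sub_sub, two_mul (m : ℤ)]

theorem exists_hasRotDeriv_of_mem_traceAlgebra
    (hc : ∀ A ∈ Matrix.specialOrthogonalGroup n ℝ, ∀ k : ℕ,
      MvPolynomial.eval (c A) (chebSum (k : ℤ)) = (A ^ k).trace)
    {g : MvPolynomial (Fin N) ℝ} (hg : g ∈ traceAlgebra N) :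
    ∃ (G : Matrix n n ℝ → ℝ) (G' : n → n → Matrix n n ℝ → ℝ), Continuous G ∧
      (∀ i j, Continuous (G' i j)) ∧ (∀ i j, HasRotDeriv i j G (G' i j)) ∧
      ∀ A ∈ Matrix.specialOrthogonalGroup n ℝ, MvPolynomial.eval (c A) g = G A ∧
        ∀ k : ℕ, k * ∑ i, ∑ j, (rotGen i j * A ^ k).trace * G' i j A =
          2 * MvPolynomial.eval (c A) (gam (chebSum (k : ℤ)) g) := by
  induction hg using Algebra.adjoin_induction with
  | mem x hx =>
    obtain ⟨l, rfl⟩ := hx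
    refine ⟨_, _, by fun_prop, fun i j => ?_, fun i j => hasRotDeriv_trace_pow i j l, fun A hA =>
      ⟨hc A hA l, fun k => ?_⟩⟩
    · fun_prop
    · have h1 : ∑ i, ∑ j, (rotGen i j * A ^ k).trace * ((l : ℝ) * (rotGen i j * A ^ l).trace) =
          (l : ℝ) * ∑ i, ∑ j, (rotGen i j * A ^ k).trace * (rotGen i j * A ^ l).trace := by
        simp only [Finset.mul_sum, mul_left_comm]
      rw [h1, sum_trace_rotGen_mul_mul_trace_rotGen_mul, gam_chebSum_chebSum,
        ← eval_chebSum_sub_eq_trace hc hA, ← pow_add, ← hc A hA, ← chebSum_neg ((k : ℤ) - l),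
        neg_sub]
      simp
      ring
  | algebraMap r =>
    refine ⟨fun _ => r, fun _ _ _ => 0, by fun_prop, fun _ _ => by fun_prop,
      fun i j => hasRotDeriv_const i j r, fun A _ => ⟨by simp, fun k => ?_⟩⟩
    simp
  | add x y _ _ hx hy =>
    obtain ⟨F, F', hF, hF', hFF', hFe⟩ := hx
    obtain ⟨G, G', hG, hG', hGG', hGe⟩ := hy
    refine ⟨_, _, hF.add hG, fun i j => (hF' i j).add (hG' i j),
      fun i j => (hFF' i j).fun_add (hGG' i j), fun A hA =>
        ⟨by simp [(hFe A hA).1, (hGe A hA).1], fun k => ?_⟩⟩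
    rw [map_add, map_add, mul_add, ← (hFe A hA).2, ← (hGe A hA).2]
    simp only [Pi.add_apply, mul_add, Finset.sum_add_distrib]
  | mul x y _ _ hx hy =>
    obtain ⟨F, F', hF, hF', hFF', hFe⟩ := hx
    obtain ⟨G, G', hG, hG', hGG', hGe⟩ := hy
    refine ⟨_, _, hF.mul hG, fun i j => ((hF' i j).mul hG).add (hF.mul (hG' i j)),
      fun i j => (hFF' i j).fun_mul (hGG' i j), fun A hA =>
        ⟨by simp [(hFe A hA).1, (hGe A hA).1], fun k => ?_⟩⟩
    have h1 := (hFe A hA).2 k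
    have h2 := (hGe A hA).2 k
    have h3 : ∑ i, ∑ j, (rotGen i j * A ^ k).trace * (F' i j A * G A + F A * G' i j A) =
        (∑ i, ∑ j, (rotGen i j * A ^ k).trace * F' i j A) * G A +
          F A * ∑ i, ∑ j, (rotGen i j * A ^ k).trace * G' i j A := by
      simp only [Finset.sum_mul, Finset.mul_sum, ← Finset.sum_add_distrib]
      exact Finset.sum_congr rfl fun i _ => Finset.sum_congr rfl fun j _ => by ring
    simp only [Pi.add_apply, Pi.mul_apply]
    rw [h3, Derivation.leibniz, smul_eq_mul, smul_eq_mul, map_add, map_mul, map_mul, (hFe A hA).1,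
      (hGe A hA).1]
    linear_combination G A * h1 + F A * h2

variable {μ : Measure (Matrix n n ℝ)} [IsProbabilityMeasure μ]

theorem integrable_eval_of_mem_traceAlgebra
    (hsupp : μ {A | A ∈ Matrix.specialOrthogonalGroup n ℝ} = 1)
    (hc : ∀ A ∈ Matrix.specialOrthogonalGroup n ℝ, ∀ k : ℕ,
      MvPolynomial.eval (c A) (chebSum (k : ℤ)) = (A ^ k).trace)
    {g : MvPolynomial (Fin N) ℝ} (hg : g ∈ traceAlgebra N) :
    Integrable (fun A => MvPolynomial.eval (c A) g) μ := by
  obtain ⟨G, G', hG, -, -, hGe⟩ := exists_hasRotDeriv_of_mem_traceAlgebra hc hg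
  exact (integrable_of_continuous_of_specialOrthogonalGroup hsupp hG).congr
    ((ae_mem_specialOrthogonalGroup hsupp).mono fun A hA => ((hGe A hA).1).symm)

/-- The Schwinger–Dyson equation obtained by integrating by parts against `Tr (A ^ k)`. -/
theorem integral_eval_drift_add_gam_eq_zero
    (hsupp : μ {A | A ∈ Matrix.specialOrthogonalGroup n ℝ} = 1)
    (hinv : ∀ g ∈ Matrix.specialOrthogonalGroup n ℝ, μ.map (fun A => g * A) = μ)
    (hc : ∀ A ∈ Matrix.specialOrthogonalGroup n ℝ, ∀ k : ℕ,
      MvPolynomial.eval (c A) (chebSum (k : ℤ)) = (A ^ k).trace)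
    (k : ℕ) {g : MvPolynomial (Fin N) ℝ} (hg : g ∈ traceAlgebra N) :
    ∫ A, MvPolynomial.eval (c A)
      (g * ((k : MvPolynomial (Fin N) ℝ) * drift k) + gam (chebSum (k : ℤ)) g) ∂μ = 0 := by
  obtain ⟨G, G', hG, hG', hGG', hGe⟩ := exists_hasRotDeriv_of_mem_traceAlgebra hc hg
  have hD : ∀ i j : n, Continuous fun A : Matrix n n ℝ =>
      (∑ m ∈ Finset.range k, (rotGen i j * A ^ m * (rotGen i j * A ^ (k - m))).trace) * G A +
        (rotGen i j * A ^ k).trace * G' i j A := fun i j => by fun_prop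
  have h0 : ∀ i j : n, ∫ A, ((∑ m ∈ Finset.range k,
      (rotGen i j * A ^ m * (rotGen i j * A ^ (k - m))).trace) * G A +
        (rotGen i j * A ^ k).trace * G' i j A) ∂μ = 0 := fun i j =>
    ((hasRotDeriv_trace_mul_pow i j (rotGen i j) k).fun_mul (hGG' i j)).integral_eq_zero hsupp
      hinv (by fun_prop) (hD i j)
  have hint := fun i j => integrable_of_continuous_of_specialOrthogonalGroup hsupp (hD i j)
  have h1 : ∫ A, (k / 2 : ℝ) * ∑ i, ∑ j, ((∑ m ∈ Finset.range k,
      (rotGen i j * A ^ m * (rotGen i j * A ^ (k - m))).trace) * G A +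
        (rotGen i j * A ^ k).trace * G' i j A) ∂μ = 0 := by
    rw [integral_const_mul, integral_finsetSum _ fun i _ => integrable_finsetSum _ fun j _ =>
      hint i j]
    simp only [integral_finsetSum _ fun j _ => hint _ j, h0, Finset.sum_const_zero, mul_zero]
  rw [← h1]
  refine integral_congr_ae ((ae_mem_specialOrthogonalGroup hsupp).mono fun A hA => ?_)
  have h2 := eval_drift hc hA k
  have h3 := (hGe A hA).2 k
  beta_reduce
  simp only [Finset.sum_add_distrib, ← Finset.sum_mul]
  rw [h2, map_add, map_mul, map_mul, map_natCast, (hGe A hA).1]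
  linear_combination -h3 / 2

end SchwingerDyson

section Moments

variable {n : Type*} [Fintype n] [DecidableEq n] {N : ℕ} {μ : Measure (Matrix n n ℝ)}
  [IsProbabilityMeasure μ]

theorem integral_trace_pow_sq (hsupp : μ {A | A ∈ Matrix.specialOrthogonalGroup n ℝ} = 1)
    (hinv : ∀ g ∈ Matrix.specialOrthogonalGroup n ℝ, μ.map (fun A => g * A) = μ)
    (hn : Fintype.card n = 2 * N) (hN : 1 ≤ N) {k : ℕ} (hk : 1 ≤ k) :
    ∫ A, (A ^ k).trace ^ 2 ∂μ = min (k : ℝ) (2 * N) + eta N k := by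
  obtain ⟨c, hc⟩ := exists_eval_chebSum_eq_trace_pow (n := n) hn
  have hint := fun g : traceAlgebra N => integrable_eval_of_mem_traceAlgebra hsupp hc g.2
  let E₀ : Subalgebra.toSubmodule (traceAlgebra N) →ₗ[ℝ] ℝ :=
    { toFun := fun g => ∫ A, MvPolynomial.eval (c A) g.1 ∂μ
      map_add' := fun f g => by
        simp only [Submodule.coe_add, map_add]
        exact integral_add (hint f) (hint g)
      map_smul' := fun r g => by
        simp [MvPolynomial.smul_eval, integral_const_mul] }
  obtain ⟨E, hE⟩ := LinearMap.exists_extend E₀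
  have hE' : ∀ g ∈ traceAlgebra N, E g = ∫ A, MvPolynomial.eval (c A) g ∂μ := fun g hg =>
    LinearMap.congr_fun hE ⟨g, hg⟩
  rw [← expectation_chebSum_sq E ?_ ?_ hN hk]
  · rw [hE' _ (pow_mem (chebSum_mem_traceAlgebra _) 2)]
    refine integral_congr_ae ((ae_mem_specialOrthogonalGroup hsupp).mono fun A hA => ?_)
    simp [hc A hA]
  · rw [hE' 1 (one_mem _)]
    simp
  · intro k g hg
    rw [hE' _ (add_mem (mul_mem hg (mul_mem (natCast_mem _ k) (drift_mem_traceAlgebra k)))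
      (gam_chebSum_mem_traceAlgebra _ hg))]
    exact integral_eval_drift_add_gam_eq_zero hsupp hinv hc k hg

end Moments

theorem eta_le_two (N k : ℕ) : eta N k ≤ 2 := by
  unfold eta eps
  split_ifs <;> norm_num

/-- For `A` Haar-distributed on `SO(2N)`,
`E[ Σ_{k≥1} Tr(A^k)²/k² ] = Σ_{k≥1} (min{k, 2N} + η(k))/k²`. -/
theorem expected_traceSum_specialOrthogonal_even
    (N : ℕ) (hN : 1 ≤ N)
    (μ : Measure (Matrix (Fin (2 * N)) (Fin (2 * N)) ℝ)) [IsProbabilityMeasure μ]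
    (hsupp : μ {A | A ∈ Matrix.specialOrthogonalGroup (Fin (2 * N)) ℝ} = 1)
    (hinv : ∀ g ∈ Matrix.specialOrthogonalGroup (Fin (2 * N)) ℝ,
      μ.map (fun A => g * A) = μ) :
    ∫ A, (∑' k : ℕ, ((A ^ (k + 1)).trace) ^ 2 / ((k : ℝ) + 1) ^ 2) ∂μ
      = ∑' k : ℕ, (min ((k : ℝ) + 1) (2 * (N : ℝ)) + eta N (k + 1)) / ((k : ℝ) + 1) ^ 2 := by
  have hF : ∀ k : ℕ, ∫ A, ((A ^ (k + 1)).trace) ^ 2 / ((k : ℝ) + 1) ^ 2 ∂μ =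
      (min ((k : ℝ) + 1) (2 * (N : ℝ)) + eta N (k + 1)) / ((k : ℝ) + 1) ^ 2 := fun k => by
    rw [integral_div, integral_trace_pow_sq hsupp hinv (Fintype.card_fin _) hN
      (Nat.le_add_left 1 k)]
    push_cast
    rfl
  rw [← integral_tsum_of_summable_integral_norm, tsum_congr hF]
  · exact fun k => integrable_of_continuous_of_specialOrthogonalGroup hsupp (by fun_prop)
  · have hnorm : ∀ k : ℕ, ∫ A : Matrix (Fin (2 * N)) (Fin (2 * N)) ℝ,
        ‖((A ^ (k + 1)).trace) ^ 2 / ((k : ℝ) + 1) ^ 2‖ ∂μ =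
        (min ((k : ℝ) + 1) (2 * (N : ℝ)) + eta N (k + 1)) / ((k : ℝ) + 1) ^ 2 := fun k => by
      rw [← hF k]
      exact integral_congr_ae (Filter.Eventually.of_forall fun A =>
        Real.norm_of_nonneg (by positivity))
    have hsum : Summable fun k : ℕ => (2 * (N : ℝ) + 2) * (1 / ((k : ℝ) + 1) ^ 2) := by
      refine Summable.mul_left _ ?_
      have := (summable_nat_add_iff 1).mpr (Real.summable_one_div_nat_pow.mpr one_lt_two)
      simpa using this
    refine hsum.of_nonneg_of_le (fun k => integral_nonneg fun A => norm_nonneg _) fun k => ?_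
    rw [hnorm, mul_one_div]
    gcongr
    · exact min_le_right _ _
    · exact eta_le_two _ _
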